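/- arXiv:1611.09304 — 8 statements merged into one kernel-verified Lean document; each statement's English description precedes it below -/
import Mathlib

section
/- For every arrival sequence X, the user dissatisfaction function (d,b) ↦ c^X(d,b) is multimodular. -/
/-- One step of the station dynamics: new number of bikes after a customer `x ∈ {−1,+1}`
arrives at a station with capacity `cap` and current number of bikes `b`. -/
def step (cap : ℕ) (b : ℕ) (x : ℤ) : ℕ :=
  (max 0 (min (cap : ℤ) ((b : ℤ) + x))).toNat

/-- Number of out-of-stock events for arrival list `X`, capacity `cap`, starting bikes `b`. -/
def cost (cap : ℕ) : ℕ → List ℤ → ℕ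
  | _, [] => 0
  | b, x :: xs => (if step cap b x = b then 1 else 0) + cost cap (step cap b x) xs

/-- The user dissatisfaction function `c^X(d,b)` for `d` initial open docks and `b` initial
bikes (so the capacity is `d + b`). -/
def udf (X : List ℤ) (d b : ℕ) : ℕ := cost (d + b) b X

/-- A function `f : ℕ² → ℝ` is multimodular (the three defining inequalities, written
with shifted indices so that all terms are well-defined over ℕ). -/
def Multimodular (f : ℕ → ℕ → ℝ) : Prop :=
  (∀ d b : ℕ, f (d+1) (b+1) - f (d+1) b ≥ f d (b+1) - f d b) ∧
  (∀ d b : ℕ, f d (b+2) - f d (b+1) ≥ f (d+1) (b+1) - f (d+1) b) ∧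
  (∀ d b : ℕ, f (d+2) b - f (d+1) b ≥ f (d+1) (b+1) - f d (b+1))

theorem udf_rent_zero (X : List ℤ) (d : ℕ) : udf (-1 :: X) d 0 = 1 + udf X d 0 := by
  have h : step (d + 0) 0 (-1) = 0 := by unfold step; omega
  simp only [udf, cost, h, if_true]

theorem udf_rent_succ (X : List ℤ) (d b : ℕ) : udf (-1 :: X) d (b+1) = udf X (d+1) b := by
  have h : step (d + (b+1)) (b+1) (-1) = b := by unfold step; omega
  have h2 : d + (b+1) = d + 1 + b := by omega
  simp only [udf, cost, h]
  rw [h2]; simp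

theorem udf_ret_zero (X : List ℤ) (b : ℕ) : udf (1 :: X) 0 b = 1 + udf X 0 b := by
  have h : step (0 + b) b 1 = b := by unfold step; omega
  simp only [udf, cost, h, if_true]

theorem udf_ret_succ (X : List ℤ) (d b : ℕ) : udf (1 :: X) (d+1) b = udf X d (b+1) := by
  have h : step (d + 1 + b) b 1 = b + 1 := by unfold step; omega
  have h2 : d + 1 + b = d + (b + 1) := by omega
  simp only [udf, cost, h]
  rw [h2]; simp

/-- Multimodularity (with additions only) together with the Lipschitz property of moving
one bike to a dock; this is preserved by prepending a customer. -/
theorem udf_invariant (X : List ℤ) (hX : ∀ x ∈ X, x = 1 ∨ x = -1) :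
    (∀ d b, udf X (d+1) (b+1) + udf X d b ≥ udf X d (b+1) + udf X (d+1) b) ∧
    (∀ d b, udf X d (b+2) + udf X (d+1) b ≥ udf X (d+1) (b+1) + udf X d (b+1)) ∧
    (∀ d b, udf X (d+2) b + udf X d (b+1) ≥ udf X (d+1) (b+1) + udf X (d+1) b) ∧
    (∀ d b, udf X d (b+1) ≤ udf X (d+1) b + 1) ∧
    (∀ d b, udf X (d+1) b ≤ udf X d (b+1) + 1) := by
  induction X with
  | nil => simp [udf, cost]
  | cons x X ih =>
    obtain ⟨h1, h2, h3, h4, h5⟩ := ih (fun y hy => hX y (List.mem_cons_of_mem _ hy))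
    rcases hX x List.mem_cons_self with rfl | rfl
    · refine ⟨?_, ?_, ?_, ?_, ?_⟩ <;> intro d b <;> rcases d with _ | d <;>
        simp only [Nat.zero_add, udf_ret_zero, udf_ret_succ,
          show 2 = 0 + 1 + 1 from rfl, ← Nat.add_assoc]
      · have := h1 0 b; have := h2 0 b; simp only [Nat.zero_add, Nat.add_assoc, Nat.reduceAdd] at *; omega
      · have := h1 d (b+1); simp only [Nat.add_assoc, Nat.reduceAdd] at *; omega
      · omega
      · have := h2 d (b+1); simp only [Nat.add_assoc, Nat.reduceAdd] at *; omega
      · have := h4 0 (b+1); simp only [Nat.zero_add, Nat.add_assoc, Nat.reduceAdd] at *; omega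
      · have := h3 d (b+1); simp only [Nat.add_assoc, Nat.reduceAdd] at *; omega
      · omega
      · have := h4 d (b+1); simp only [Nat.add_assoc, Nat.reduceAdd] at *; omega
      · omega
      · have := h5 d (b+1); simp only [Nat.add_assoc, Nat.reduceAdd] at *; omega
    · refine ⟨?_, ?_, ?_, ?_, ?_⟩ <;> intro d b <;> rcases b with _ | b <;>
        simp only [Nat.zero_add, udf_rent_zero, udf_rent_succ,
          show 2 = 0 + 1 + 1 from rfl, ← Nat.add_assoc]
      · have := h1 d 0; have := h3 d 0; simp only [Nat.zero_add, Nat.add_assoc, Nat.reduceAdd] at *; omega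
      · have := h1 (d+1) b; simp only [Nat.add_assoc, Nat.reduceAdd] at *; omega
      · have := h5 (d+1) 0; simp only [Nat.zero_add, Nat.add_assoc, Nat.reduceAdd] at *; omega
      · have := h2 (d+1) b; simp only [Nat.add_assoc, Nat.reduceAdd] at *; omega
      · omega
      · have := h3 (d+1) b; simp only [Nat.add_assoc, Nat.reduceAdd] at *; omega
      · omega
      · have := h4 (d+1) b; simp only [Nat.add_assoc, Nat.reduceAdd] at *; omega
      · omega
      · have := h5 (d+1) b; simp only [Nat.add_assoc, Nat.reduceAdd] at *; omega

/-- For every arrival sequence `X`, the user dissatisfaction function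
`(d,b) ↦ c^X(d,b)` is multimodular. -/
theorem udf_multimodular (X : List ℤ) (hX : ∀ x ∈ X, x = 1 ∨ x = -1) :
    Multimodular (fun d b => (udf X d b : ℝ)) := by
  obtain ⟨h1, h2, h3, -, -⟩ := udf_invariant X hX
  refine ⟨fun d b => ?_, fun d b => ?_, fun d b => ?_⟩
  · have : (udf X (d+1) (b+1) + udf X d b : ℝ) ≥ udf X d (b+1) + udf X (d+1) b := by
      exact_mod_cast h1 d b
    dsimp only; linarith
  · have : (udf X d (b+2) + udf X (d+1) b : ℝ) ≥ udf X (d+1) (b+1) + udf X d (b+1) := by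
      exact_mod_cast h2 d b
    dsimp only; linarith
  · have : (udf X (d+2) b + udf X d (b+1) : ℝ) ≥ udf X (d+1) (b+1) + udf X (d+1) b := by
      exact_mod_cast h3 d b
    dsimp only; linarith
end

section
/- If f : ℕ² → ℝ is multimodular and α ≥ 1 is an integer, then the function (d,b) ↦ f(α·d, α·b) is multimodular. -/
theorem mm_aux1 (f : ℕ → ℕ → ℝ)
    (h : ∀ d b : ℕ, f (d+1) (b+1) - f (d+1) b ≥ f d (b+1) - f d b) (m n d b : ℕ) :
    f (d+m) (b+n) - f (d+m) b ≥ f d (b+n) - f d b := by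
  have s1 : ∀ m d b : ℕ, f (d+m) (b+1) - f (d+m) b ≥ f d (b+1) - f d b := by
    intro m
    induction m with
    | zero => intro d b; exact le_refl _
    | succ m ih =>
      intro d b
      have h1 := ih d b
      have h2 := h (d+m) b
      rw [← add_assoc]
      linarith
  induction n with
  | zero => simp
  | succ n ih =>
    have h1 := s1 m d (b+n)
    rw [← add_assoc]
    linarith

theorem mm_aux2 (f : ℕ → ℕ → ℝ)
    (h : ∀ d b : ℕ, f d (b+2) - f d (b+1) ≥ f (d+1) (b+1) - f (d+1) b) (m n d b : ℕ) :
    f d (b+m+n) - f d (b+m) ≥ f (d+m) (b+n) - f (d+m) b := by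
  have s1 : ∀ m d b : ℕ, f d (b+m+1) - f d (b+m) ≥ f (d+m) (b+1) - f (d+m) b := by
    intro m
    induction m with
    | zero => intro d b; exact le_refl _
    | succ m ih =>
      intro d b
      have h1 := ih (d+1) b
      have h2 := h d (b+m)
      rw [show d + 1 + m = d + (m+1) by ring] at h1
      rw [show b + (m+1) + 1 = b + m + 2 by ring, ← add_assoc b m 1]
      linarith
  induction n with
  | zero => simp
  | succ n ih =>
    have h1 := s1 m d (b+n)
    rw [show b + n + m = b + m + n by ring] at h1
    rw [← add_assoc, ← add_assoc]
    linarith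

/-- If `f : ℕ² → ℝ` is multimodular and `α ≥ 1` is an integer, then
`(d,b) ↦ f(α·d, α·b)` is multimodular. -/
theorem multimodular_scaling (f : ℕ → ℕ → ℝ) (hf : Multimodular f)
    (α : ℕ) (hα : 1 ≤ α) :
    Multimodular (fun d b => f (α * d) (α * b)) := by
  obtain ⟨h1, h2, h3⟩ := hf
  refine ⟨fun d b => ?_, fun d b => ?_, fun d b => ?_⟩
  · have := mm_aux1 f h1 α α (α*d) (α*b)
    simpa only [mul_add, mul_one] using this
  · have := mm_aux2 f h2 α α (α*d) (α*b)
    simpa only [mul_add, mul_one, mul_two, ← add_assoc] using this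
  · have := mm_aux2 (fun x y => f y x) (fun x y => h3 y x) α α (α*b) (α*d)
    simpa only [mul_add, mul_one, mul_two, ← add_assoc] using this
end

section
/- Exchanging a single empty dock for a bike at a station changes the user dissatisfaction function by at most 1: for every arrival sequence X and all integers d ≥ 1, b ≥ 0, one has |c^X(d,b) − c^X(d−1, b+1)| ≤ 1. -/
theorem cost_adjacent (cap : ℕ) (X : List ℤ) (hX : ∀ x ∈ X, x = 1 ∨ x = -1) :
    ∀ b : ℕ, b + 1 ≤ cap → |(cost cap b X : ℤ) - (cost cap (b + 1) X : ℤ)| ≤ 1 := by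
  induction X with
  | nil => intro b _; simp [cost]
  | cons x xs ih =>
    intro b hb
    have ih' := ih (fun y hy => hX y (List.mem_cons_of_mem _ hy))
    simp only [cost]
    rcases hX x List.mem_cons_self with rfl | rfl
    · have h1 : step cap b 1 = b + 1 := by unfold step; omega
      by_cases hc : b + 1 = cap
      · have h2 : step cap (b + 1) 1 = b + 1 := by unfold step; omega
        simp [h1, h2]
      · have h2 : step cap (b + 1) 1 = b + 1 + 1 := by unfold step; omega
        simpa [h1, h2] using ih' (b + 1) (by omega)
    · have h1 : step cap (b + 1) (-1) = b := by unfold step; omega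
      rcases b with _ | b
      · have h2 : step cap 0 (-1) = 0 := by unfold step; omega
        rw [h1, h2]
        simp
      · have h2 : step cap (b + 1) (-1) = b := by unfold step; omega
        rw [h1, h2]
        simpa using ih' b (by omega)

/-- Exchanging a single empty dock for a bike changes the user dissatisfaction
function by at most 1: for every ±1 arrival sequence `X` and all `d ≥ 1`, `b ≥ 0`,
`|c^X(d,b) − c^X(d−1,b+1)| ≤ 1`. -/
theorem udf_exchange_dock_for_bike (X : List ℤ) (hX : ∀ x ∈ X, x = 1 ∨ x = -1)
    (d b : ℕ) (hd : 1 ≤ d) :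
    |(udf X d b : ℤ) - (udf X (d - 1) (b + 1) : ℤ)| ≤ 1 := by
  have h : d - 1 + (b + 1) = d + b := by omega
  unfold udf
  rw [h]
  exact cost_adjacent (d + b) X hX b (by omega)
end

section
/- For every arrival sequence X and all nonnegative integers d′ ≤ d and b′ ≤ b, one has c^X(d′,b′) − c^X(d,b) = c^{X(d,b)}(d′,b′) − c^{X(d,b)}(d,b) = c^{X(d,b)}(d′,b′), where X(d,b) denotes the uncensored subsequence of X with respect to the initial condition (d,b). -/
/-- The uncensored subsequence of `X` w.r.t. capacity `cap` and initial bikes `b`: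
the subsequence of customers whose rental/return succeeds. -/
def uncensored (cap : ℕ) : ℕ → List ℤ → List ℤ
  | _, [] => []
  | b, x :: xs =>
    if step cap b x = b then uncensored cap (step cap b x) xs
    else x :: uncensored cap (step cap b x) xs

theorem uncensored_aux (cap cap' : ℕ) (X : List ℤ) (hX : ∀ x ∈ X, x = 1 ∨ x = -1) :
    ∀ b b' : ℕ, b' ≤ b → b ≤ cap → b' ≤ cap' → cap' + b ≤ cap + b' →
      cost cap' b' X = cost cap b X + cost cap' b' (uncensored cap b X) ∧
      cost cap b (uncensored cap b X) = 0 := by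
  induction X with
  | nil => intros; simp [cost, uncensored]
  | cons x xs ih =>
    intro b b' h1 h2 h3 h4
    have hx := hX x (by simp)
    have ih := ih (fun y hy => hX y (by simp [hy])) (step cap b x) (step cap' b' x)
      (by unfold step; omega) (by unfold step; omega) (by unfold step; omega)
      (by rcases hx with rfl | rfl <;> unfold step <;> omega)
    by_cases h : step cap b x = b
    · have h' : step cap' b' x = b' := by
        revert h; rcases hx with rfl | rfl <;> unfold step <;> omega
      rw [h, h'] at ih
      simp only [cost, uncensored, h, h', if_true]
      exact ⟨by omega, ih.2⟩
    · simp only [cost, uncensored, h, if_false]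
      exact ⟨by omega, by omega⟩

/-- For every arrival sequence `X` and all `d′ ≤ d`, `b′ ≤ b`:
`c^X(d′,b′) − c^X(d,b) = c^{X(d,b)}(d′,b′) − c^{X(d,b)}(d,b) = c^{X(d,b)}(d′,b′)`,
where `X(d,b)` is the uncensored subsequence of `X` w.r.t. initial condition `(d,b)`. -/
theorem udf_uncensored_difference (X : List ℤ) (hX : ∀ x ∈ X, x = 1 ∨ x = -1)
    (d b d' b' : ℕ) (hd : d' ≤ d) (hb : b' ≤ b) :
    (udf X d' b' : ℤ) - (udf X d b : ℤ) =
      (udf (uncensored (d + b) b X) d' b' : ℤ) - (udf (uncensored (d + b) b X) d b : ℤ) ∧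
    udf (uncensored (d + b) b X) d b = 0 := by
  have h := uncensored_aux (d + b) (d' + b') X hX b b' hb (by omega) (by omega) (by omega)
  unfold udf
  refine ⟨?_, h.2⟩
  rw [h.1, h.2]
  push_cast
  ring
end

section
/- Suppose the allocation (d⃗,b⃗) is bike-optimal, and let i, j be stations with d_i + b_i ≥ 1. Then among the dock-moves from i to j that are defined at (d⃗,b⃗) — namely e_{ij}(d⃗,b⃗), o_{ij}(d⃗,b⃗), and E_{ijh}(d⃗,b⃗), O_{ijh}(d⃗,b⃗) for stations h — at least one yields a bike-optimal allocation. Equivalently, when moving a dock from i to j, at most one bike needs to be moved within the system to maintain bike-optimality. -/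
/-- An allocation over `n` stations: open docks and bikes at each station. -/
abbrev Alloc (n : ℕ) := (Fin n → ℕ) × (Fin n → ℕ)

/-- Objective: total expected user dissatisfaction `c(d⃗,b⃗) = Σ_i c_i(d_i,b_i)`. -/
def obj {n : ℕ} (c : Fin n → ℕ → ℕ → ℝ) (a : Alloc n) : ℝ :=
  ∑ i, c i (a.1 i) (a.2 i)

/-- Move one unit of the vector `v` from coordinate `i` to coordinate `j`. -/
def moveOne {n : ℕ} (v : Fin n → ℕ) (i j : Fin n) : Fin n → ℕ :=
  fun k => v k - (if k = i then 1 else 0) + (if k = j then 1 else 0)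

/-- The set of allocations obtained from `a` by a single dock-move from station `i` to
station `j`: one of `o_{ij}`, `e_{ij}`, `E_{ijh}`, `O_{ijh}` (defined whenever the
result is componentwise nonnegative). -/
def MoveFromTo {n : ℕ} (a : Alloc n) (i j : Fin n) : Set (Alloc n) :=
  {a' | (1 ≤ a.1 i ∧ a' = (moveOne a.1 i j, a.2)) ∨
        (1 ≤ a.2 i ∧ a' = (a.1, moveOne a.2 i j)) ∨
        (∃ h, 1 ≤ a.1 i ∧ 1 ≤ a.2 h ∧ a' = (moveOne a.1 i h, moveOne a.2 h j)) ∨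
        (∃ h, 1 ≤ a.1 h ∧ 1 ≤ a.2 i ∧ a' = (moveOne a.1 h j, moveOne a.2 i h))}

/-- The neighborhood `N(a)`: all allocations one dock-move away from `a`. -/
def Neighborhood {n : ℕ} (a : Alloc n) : Set (Alloc n) :=
  ⋃ (i : Fin n) (j : Fin n), MoveFromTo a i j

/-- Dock-move distance `Σ_i |(d_i+b_i) − (d_i′+b_i′)|`. -/
def dockDist {n : ℕ} (a a' : Alloc n) : ℕ :=
  ∑ i, ((a.1 i + a.2 i : ℤ) - (a'.1 i + a'.2 i : ℤ)).natAbs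

/-- `a` is bike-optimal: it minimizes the objective among allocations with the same
number of docks at each station and the same total number of bikes. -/
def BikeOptimal {n : ℕ} (c : Fin n → ℕ → ℕ → ℝ) (a : Alloc n) : Prop :=
  ∀ a' : Alloc n, (∀ i, a'.1 i + a'.2 i = a.1 i + a.2 i) →
    (∑ i, a'.2 i = ∑ i, a.2 i) → obj c a ≤ obj c a'

/-- The `z`-ball `S_z(a)` around allocation `a`. -/
def ball {n : ℕ} (a : Alloc n) : ℕ → Set (Alloc n)
  | 0 => {a}
  | z + 1 => ball a z ∪ ⋃ a' ∈ ball a z, Neighborhood a'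

/-- The slope of moving up by one bike (at fixed capacity) is at least `l`. -/
def RtC (f : ℕ → ℕ → ℝ) (l : ℝ) (d b : ℕ) : Prop :=
  ∀ d', d = d' + 1 → l ≤ f d' (b + 1) - f d b

/-- Local optimality with multiplier `l`. -/
def LocC (f : ℕ → ℕ → ℝ) (l : ℝ) (d b : ℕ) : Prop :=
  RtC f l d b ∧ RtC (flip f) (-l) b d

theorem mm_flip {f : ℕ → ℕ → ℝ} (h : Multimodular f) : Multimodular (flip f) := by
  obtain ⟨h1, h2, h3⟩ := h
  refine ⟨fun d b => ?_, fun d b => ?_, fun d b => ?_⟩ <;> simp only [flip]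
  · linarith [h1 b d]
  · linarith [h3 b d]
  · linarith [h2 b d]

theorem LocC.flip {f : ℕ → ℕ → ℝ} {l : ℝ} {d b : ℕ} (h : LocC f l d b) :
    LocC (flip f) (-l) b d := by
  refine ⟨h.2, ?_⟩
  rw [neg_neg]
  exact h.1

theorem LocC.unflip {f : ℕ → ℕ → ℝ} {l : ℝ} {d b : ℕ} (h : LocC (_root_.flip f) l b d) :
    LocC f (-l) d b := ⟨h.2, by rw [neg_neg]; exact h.1⟩

theorem RtC.mono {f : ℕ → ℕ → ℝ} {l m : ℝ} {d b : ℕ} (h : RtC f l d b) (hm : m ≤ l) :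
    RtC f m d b := fun d' e => hm.trans (h d' e)

theorem RtC.dock {f : ℕ → ℕ → ℝ} (hf : Multimodular f) {l : ℝ} {d b : ℕ}
    (h : RtC f l (d + 1) b) : RtC f l d b := by
  rintro d' rfl
  have := h (d' + 1) rfl
  have := hf.2.2 d' b
  linarith

theorem RtC.bike {f : ℕ → ℕ → ℝ} (hf : Multimodular f) {l : ℝ} {d b : ℕ}
    (h : RtC f l d b) : RtC f l d (b + 1) := by
  rintro d' rfl
  have := h d' rfl
  have := hf.2.1 d' b
  linarith

theorem RtC.step {f : ℕ → ℕ → ℝ} (hf : Multimodular f) {l : ℝ} {d b : ℕ}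
    (h : RtC f l (d + 1) b) : RtC f l d (b + 1) := (h.dock hf).bike hf

theorem RtC.up {f : ℕ → ℕ → ℝ} (hf : Multimodular f) {l : ℝ} (t : ℕ) :
    ∀ {d b : ℕ}, RtC f l (d + t) b → f (d + t) b + l * t ≤ f d (b + t) := by
  induction t with
  | zero => intro d b _; simp
  | succ t ih =>
    intro d b h
    have h1 := h (d + t) rfl
    have h2 := ih (RtC.step hf (d := d + t) h)
    rw [show b + 1 + t = b + (t + 1) by omega] at h2
    rw [show d + (t + 1) = d + t + 1 by omega] at *
    push_cast
    linarith

theorem LocC.glob {f : ℕ → ℕ → ℝ} (hf : Multimodular f) {l : ℝ} {d b d' b' : ℕ}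
    (h : LocC f l d b) (e : d' + b' = d + b) : f d b - l * b ≤ f d' b' - l * b' := by
  rcases le_total b b' with hb | hb
  · obtain ⟨t, rfl⟩ := Nat.exists_eq_add_of_le hb
    obtain rfl : d = d' + t := by omega
    have := RtC.up hf t h.1
    push_cast
    linarith
  · obtain ⟨t, rfl⟩ := Nat.exists_eq_add_of_le hb
    obtain rfl : d' = d + t := by omega
    have := RtC.up (mm_flip hf) t h.2
    simp only [_root_.flip] at this
    push_cast
    linarith

theorem bikeOptimal_of_loc {n : ℕ} (c : Fin n → ℕ → ℕ → ℝ)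
    (hc : ∀ i, Multimodular (c i)) (a : Alloc n) (l : ℝ)
    (h : ∀ k, LocC (c k) l (a.1 k) (a.2 k)) : BikeOptimal c a := by
  intro a' hs hb
  have := Finset.sum_le_sum (s := Finset.univ) (fun k _ => (h k).glob (hc k) (hs k))
  simp only [Finset.sum_sub_distrib, ← Finset.mul_sum] at this
  have hb' : (∑ k, (a'.2 k : ℝ)) = ∑ k, (a.2 k : ℝ) := by exact_mod_cast hb
  rw [hb'] at this
  unfold obj
  linarith

theorem exists_sep (L R : Finset ℝ) (h : ∀ x ∈ L, ∀ y ∈ R, x ≤ y) :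
    ∃ l, (∀ x ∈ L, x ≤ l) ∧ ∀ y ∈ R, l ≤ y := by
  rcases L.eq_empty_or_nonempty with rfl | hL
  · rcases R.eq_empty_or_nonempty with rfl | hR
    · exact ⟨0, by simp, by simp⟩
    · exact ⟨R.min' hR, by simp, fun y hy => R.min'_le y hy⟩
  · exact ⟨L.max' hL, fun x hx => L.le_max' x hx, fun y hy => h _ (L.max'_mem hL) y hy⟩

theorem exchange {n : ℕ} (c : Fin n → ℕ → ℕ → ℝ)
    (hc : ∀ i, Multimodular (c i)) (a : Alloc n) (hopt : BikeOptimal c a)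
    (k m : Fin n) (p q : ℕ) (hp : a.2 k = p + 1) (hq : a.1 m = q + 1) :
    c k (a.1 k) (p + 1) - c k (a.1 k + 1) p ≤ c m q (a.2 m + 1) - c m (q + 1) (a.2 m) := by
  by_cases hkm : k = m
  · subst hkm
    rw [hp, hq]
    have h2 := (hc k).2.1 q p
    have h3 := (hc k).2.2 q p
    linarith
  · have h := hopt (fun x => if x = k then a.1 k + 1 else if x = m then q else a.1 x,
      fun x => if x = k then p else if x = m then a.2 m + 1 else a.2 x) ?_ ?_
    · unfold obj at h
      rw [← sub_nonneg, ← Finset.sum_sub_distrib, Fintype.sum_eq_add k m hkm] at h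
      · simp only [if_true, if_neg (Ne.symm hkm), hp, hq] at h
        linarith
      · rintro x ⟨h1, h2⟩
        simp [h1, h2]
    · intro x
      dsimp only
      split_ifs with h1 h2
      · subst h1; omega
      · subst h2; omega
      · rfl
    · have : ∑ x, (((if x = k then p else if x = m then a.2 m + 1 else a.2 x : ℕ) : ℤ) - (a.2 x : ℤ)) = 0 := by
        rw [Fintype.sum_eq_add k m hkm]
        · simp only [if_true, if_neg (Ne.symm hkm), hp]
          push_cast
          ring
        · rintro x ⟨h1, h2⟩
          simp [h1, h2]
      rw [Finset.sum_sub_distrib, sub_eq_zero] at this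
      exact_mod_cast this

theorem exists_mult {n : ℕ} (c : Fin n → ℕ → ℕ → ℝ)
    (hc : ∀ i, Multimodular (c i)) (a : Alloc n) (hopt : BikeOptimal c a) :
    ∃ l, ∀ k, LocC (c k) l (a.1 k) (a.2 k) := by
  classical
  obtain ⟨l, h1, h2⟩ := exists_sep
    ((Finset.univ.filter fun k => 1 ≤ a.2 k).image
      fun k => c k (a.1 k) (a.2 k) - c k (a.1 k + 1) (a.2 k - 1))
    ((Finset.univ.filter fun k => 1 ≤ a.1 k).image
      fun k => c k (a.1 k - 1) (a.2 k + 1) - c k (a.1 k) (a.2 k)) (by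
      intro x hx y hy
      simp only [Finset.mem_image, Finset.mem_filter, Finset.mem_univ, true_and] at hx hy
      obtain ⟨k, hk, rfl⟩ := hx
      obtain ⟨m, hm, rfl⟩ := hy
      have := exchange c hc a hopt k m (a.2 k - 1) (a.1 m - 1) (by omega) (by omega)
      rwa [Nat.sub_add_cancel hk, Nat.sub_add_cancel hm] at this)
  refine ⟨l, fun k => ⟨fun d' e => ?_, fun b' e => ?_⟩⟩
  · have := h2 _ (Finset.mem_image_of_mem _ (Finset.mem_filter.2 ⟨Finset.mem_univ k, by omega⟩))
    rwa [show a.1 k - 1 = d' by omega] at this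
  · have := h1 _ (Finset.mem_image_of_mem _ (Finset.mem_filter.2 ⟨Finset.mem_univ k, by omega⟩))
    rw [show a.2 k - 1 = b' by omega] at this
    simp only [flip]
    linarith

theorem augment {n : ℕ} (c : Fin n → ℕ → ℕ → ℝ)
    (hc : ∀ i, Multimodular (c i)) (d b : Fin n → ℕ) (l : ℝ)
    (h : ∀ k, LocC (c k) l (d k) (b k)) (k0 : Fin n) (hk : 1 ≤ d k0) :
    ∃ (x : Fin n) (m : ℝ), 1 ≤ d x ∧ ∀ k, LocC (c k) m
      (d k - if k = x then 1 else 0) (b k + if k = x then 1 else 0) := by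
  obtain ⟨x, hx, hmin⟩ := Finset.exists_min_image (Finset.univ.filter fun k => 1 ≤ d k)
    (fun k => c k (d k - 1) (b k + 1) - c k (d k) (b k)) ⟨k0, by simpa using hk⟩
  have hx' : 1 ≤ d x := by simpa using hx
  have hl : l ≤ c x (d x - 1) (b x + 1) - c x (d x) (b x) := (h x).1 _ (by omega)
  refine ⟨x, c x (d x - 1) (b x + 1) - c x (d x) (b x), hx', fun k => ?_⟩
  by_cases hkx : k = x
  · subst hkx
    obtain ⟨e, he⟩ : ∃ e, d k = e + 1 := ⟨d k - 1, by omega⟩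
    simp only [if_true, he, Nat.add_sub_cancel]
    refine ⟨RtC.step (hc k) ?_, ?_⟩
    · intro d' hd'
      obtain rfl : e = d' := by omega
      exact le_rfl
    · intro b' hb'
      obtain rfl : b k = b' := by omega
      simp [flip]
  · simp only [if_neg hkx, Nat.sub_zero, Nat.add_zero]
    refine ⟨fun d' hd' => ?_, (h k).2.mono (by linarith)⟩
    have := hmin k (by simp; omega)
    rwa [show d k - 1 = d' by omega] at this

theorem remove_dock {f : ℕ → ℕ → ℝ} (hf : Multimodular f) {l : ℝ} {d b : ℕ}
    (h : LocC f l d b) (hs : 1 ≤ d + b) :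
    (1 ≤ d ∧ LocC f l (d - 1) b) ∨ (1 ≤ b ∧ LocC f l d (b - 1)) := by
  have hff := mm_flip hf
  rcases d with _ | d
  · right
    obtain ⟨b, rfl⟩ : ∃ e, b = e + 1 := ⟨b - 1, by omega⟩
    exact ⟨by omega, fun d' hd' => by omega, h.2.dock hff⟩
  · rcases b with _ | b
    · left
      exact ⟨by omega, h.1.dock hf, fun d' hd' => by omega⟩
    · rcases le_total (f d (b + 1) - f (d + 1) b) l with hl | hl
      · left
        refine ⟨by omega, h.1.dock hf, fun b' hb' => ?_⟩
        obtain rfl : b = b' := by omega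
        simp only [flip, Nat.add_sub_cancel]
        linarith
      · right
        refine ⟨by omega, fun d' hd' => ?_, h.2.dock hff⟩
        obtain rfl : d = d' := by omega
        simpa using hl

theorem add_dock {f : ℕ → ℕ → ℝ} (hf : Multimodular f) {l : ℝ} {d b : ℕ}
    (h : LocC f l d b) : LocC f l (d + 1) b ∨ LocC f l d (b + 1) := by
  have hff := mm_flip hf
  rcases le_total (f d (b + 1) - f (d + 1) b) l with hl | hl
  · right
    refine ⟨h.1.bike hf, fun b' hb' => ?_⟩
    obtain rfl : b = b' := by omega
    simp only [flip]
    linarith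
  · left
    refine ⟨fun d' hd' => ?_, h.2.bike hff⟩
    obtain rfl : d = d' := by omega
    exact hl

/-- If `(d⃗,b⃗)` is bike-optimal and `i,j` are stations with `d_i + b_i ≥ 1`, then among
the dock-moves from `i` to `j` defined at `(d⃗,b⃗)` at least one yields a bike-optimal
allocation. -/
theorem dock_move_preserves_bike_optimality {n : ℕ} (c : Fin n → ℕ → ℕ → ℝ)
    (hc : ∀ i, Multimodular (c i)) (a : Alloc n) (hopt : BikeOptimal c a)
    (i j : Fin n) (hi : 1 ≤ a.1 i + a.2 i) :
    ∃ a' ∈ MoveFromTo a i j, BikeOptimal c a' := by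
  obtain ⟨l, hl⟩ := exists_mult c hc a hopt
  by_cases hij : i = j
  · subst hij
    have key : ∀ v : Fin n → ℕ, 1 ≤ v i → moveOne v i i = v := by
      intro v hv
      funext k
      unfold moveOne
      split_ifs with hk
      · subst hk; omega
      · rfl
    refine ⟨a, ?_, hopt⟩
    by_cases hd : 1 ≤ a.1 i
    · left
      exact ⟨hd, by rw [key _ hd]⟩
    · right; left
      have hb : 1 ≤ a.2 i := by omega
      exact ⟨hb, by rw [key _ hb]⟩
  have hji : j ≠ i := Ne.symm hij
  rcases remove_dock (hc i) (hl i) hi with ⟨hdi, hI⟩ | ⟨hbi, hI⟩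
  · rcases add_dock (hc j) (hl j) with hJ | hJ
    · -- keep both
      refine ⟨(moveOne a.1 i j, a.2), Or.inl ⟨hdi, rfl⟩, bikeOptimal_of_loc c hc _ l fun k => ?_⟩
      by_cases h1 : k = i
      · subst h1; simpa [moveOne, hij] using hI
      · by_cases h2 : k = j
        · subst h2; simpa [moveOne, h1] using hJ
        · simpa [moveOne, h1, h2] using hl k
    · -- one bike too many
      obtain ⟨h, m, hh, hm⟩ := augment (fun k => flip (c k)) (fun k => mm_flip (hc k))
        (fun k => a.2 k + if k = j then 1 else 0) (fun k => a.1 k - if k = i then 1 else 0) (-l)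
        (fun k => by
          by_cases h1 : k = i
          · subst h1; simpa [hij] using hI.flip
          · by_cases h2 : k = j
            · subst h2; simpa [h1] using hJ.flip
            · simpa [h1, h2] using (hl k).flip) j (by simp)
      by_cases hhj : h = j
      · subst hhj
        refine ⟨(moveOne a.1 i h, a.2), Or.inl ⟨hdi, rfl⟩,
          bikeOptimal_of_loc c hc _ (-m) fun k => ?_⟩
        have := (hm k).unflip
        simpa [moveOne] using this
      · simp only [if_neg hhj, Nat.add_zero] at hh
        refine ⟨(moveOne a.1 i h, moveOne a.2 h j), Or.inr (Or.inr (Or.inl ⟨h, hdi, hh, rfl⟩)),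
          bikeOptimal_of_loc c hc _ (-m) fun k => ?_⟩
        have := (hm k).unflip
        simp only [moveOne]
        convert this using 1
        by_cases h1 : k = h
        · subst h1; simp [hhj]
        · simp [h1]
  · rcases add_dock (hc j) (hl j) with hJ | hJ
    · obtain ⟨h, m, hh, hm⟩ := augment c hc
        (fun k => a.1 k + if k = j then 1 else 0) (fun k => a.2 k - if k = i then 1 else 0) l
        (fun k => by
          by_cases h1 : k = i
          · subst h1; simpa [hij] using hI
          · by_cases h2 : k = j
            · subst h2; simpa [h1] using hJ
            · simpa [h1, h2] using hl k) j (by simp)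
      by_cases hhj : h = j
      · subst hhj
        refine ⟨(a.1, moveOne a.2 i h), Or.inr (Or.inl ⟨hbi, rfl⟩),
          bikeOptimal_of_loc c hc _ m fun k => ?_⟩
        simpa [moveOne] using hm k
      · simp only [if_neg hhj, Nat.add_zero] at hh
        refine ⟨(moveOne a.1 h j, moveOne a.2 i h), Or.inr (Or.inr (Or.inr ⟨h, hh, hbi, rfl⟩)),
          bikeOptimal_of_loc c hc _ m fun k => ?_⟩
        simp only [moveOne]
        convert hm k using 1
        by_cases h1 : k = h
        · subst h1; simp [hhj]
        · simp [h1]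
    · refine ⟨(a.1, moveOne a.2 i j), Or.inr (Or.inl ⟨hbi, rfl⟩),
        bikeOptimal_of_loc c hc _ l fun k => ?_⟩
      by_cases h1 : k = i
      · subst h1; simpa [moveOne, hij] using hI
      · by_cases h2 : k = j
        · subst h2; simpa [moveOne, h1] using hJ
        · simpa [moveOne, h1, h2] using hl k
end

section
/- Suppose the allocation (d⃗,b⃗) is bike-optimal and there exists an allocation (d⃗*,b⃗*) with Σ_i (d_i*+b_i*) = Σ_i (d_i+b_i), Σ_i b_i* = Σ_i b_i, and c(d⃗*,b⃗*) < c(d⃗,b⃗). Then there exists an allocation (d⃗′,b⃗′) in the neighborhood N(d⃗,b⃗) such that c(d⃗′,b⃗′) < c(d⃗,b⃗) and the dock-move distance from (d⃗′,b⃗′) to (d⃗*,b⃗*) is strictly smaller than the dock-move distance from (d⃗,b⃗) to (d⃗*,b⃗*). -/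
/-- Abstract conic lower bound on a grid. -/
lemma grid_bound (F : ℕ → ℕ → ℝ) (p q : ℕ)
    (h1 : ∀ i j, i + 2 ≤ p → j ≤ q → F (i+2) j - F (i+1) j ≥ F (i+1) j - F i j)
    (h2 : ∀ i j, i ≤ p → j + 2 ≤ q → F i (j+2) - F i (j+1) ≥ F i (j+1) - F i j)
    (h3 : ∀ i j, i + 1 ≤ p → j + 1 ≤ q → F (i+1) (j+1) - F (i+1) j ≥ F i (j+1) - F i j) :
    F p q - F 0 0 ≥ p * (F 1 0 - F 0 0) + q * (F 0 1 - F 0 0) := by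
  have A : ∀ i, i + 1 ≤ p → F (i+1) 0 - F i 0 ≥ F 1 0 - F 0 0 := by
    intro i
    induction i with
    | zero => intro _; simp
    | succ k ih =>
      intro hk
      have := h1 k 0 (by omega) (by omega)
      have := ih (by omega)
      simp only [add_assoc, one_add_one_eq_two] at *
      linarith
  have A' : ∀ i, i ≤ p → F i 0 - F 0 0 ≥ i * (F 1 0 - F 0 0) := by
    intro i
    induction i with
    | zero => intro _; simp
    | succ k ih =>
      intro hk
      have := A k hk
      have := ih (by omega)
      push_cast
      linarith
  have B0 : 1 ≤ q → ∀ i, i ≤ p → F i 1 - F i 0 ≥ F 0 1 - F 0 0 := by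
    intro hq i
    induction i with
    | zero => intro _; simp
    | succ k ih =>
      intro hk
      have := h3 k 0 (by omega) (by omega)
      have := ih (by omega)
      simp only [zero_add] at *
      linarith
  have B : ∀ j, j + 1 ≤ q → F p (j+1) - F p j ≥ F 0 1 - F 0 0 := by
    intro j
    induction j with
    | zero => intro h; exact B0 h p le_rfl
    | succ k ih =>
      intro hk
      have := h2 p k (by omega) (by omega)
      have := ih (by omega)
      simp only [add_assoc, one_add_one_eq_two] at *
      linarith
  have B' : ∀ j, j ≤ q → F p j - F p 0 ≥ j * (F 0 1 - F 0 0) := by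
    intro j
    induction j with
    | zero => intro _; simp
    | succ k ih =>
      intro hk
      have := B k hk
      have := ih (by omega)
      push_cast
      linarith
  have := A' p le_rfl
  have := B' q le_rfl
  linarith

/-- The lower bound at a single station. -/
lemma station_bound (f : ℕ → ℕ → ℝ) (hf : Multimodular f) (d b d' b' : ℕ) :
    f d' b' - f d b ≥
      (((d' - d) - (b - b') : ℕ) : ℝ) * (f (d+1) b - f d b)
      + (((d - d') - (b' - b) : ℕ) : ℝ) * (f (d-1) b - f d b)
      + (((b' - b) - (d - d') : ℕ) : ℝ) * (f d (b+1) - f d b)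
      + (((b - b') - (d' - d) : ℕ) : ℝ) * (f d (b-1) - f d b)
      + ((min (d - d') (b' - b) : ℕ) : ℝ) * (f (d-1) (b+1) - f d b)
      + ((min (d' - d) (b - b') : ℕ) : ℝ) * (f (d+1) (b-1) - f d b) := by
  obtain ⟨m1, m2, m3⟩ := hf
  rcases le_total d d' with hd | hd <;> rcases le_total b b' with hb | hb
  · -- both up
    obtain ⟨p, rfl⟩ := Nat.exists_eq_add_of_le hd
    obtain ⟨q, rfl⟩ := Nat.exists_eq_add_of_le hb
    have := grid_bound (fun i j => f (d+i) (b+j)) p q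
      (fun i j _ _ => by
        have e1 := m1 (d+i) (b+j); have e3 := m3 (d+i) (b+j)
        simp only [← add_assoc] at *; linarith)
      (fun i j _ _ => by
        have e1 := m1 (d+i) (b+j); have e3 := m2 (d+i) (b+j)
        simp only [← add_assoc] at *; linarith)
      (fun i j _ _ => by
        have e1 := m1 (d+i) (b+j)
        simp only [← add_assoc] at *; linarith)
    have z1 : d - (d + p) = 0 := by omega
    have z2 : b - (b + q) = 0 := by omega
    simp [z1, z2] at this ⊢
    linarith
  · obtain ⟨p, rfl⟩ := Nat.exists_eq_add_of_le hd
    obtain ⟨q, rfl⟩ := Nat.exists_eq_add_of_le hb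
    have z1 : d - (d + p) = 0 := by omega
    have z2 : b' - (b' + q) = 0 := by omega
    rcases le_total p q with h | h
    · -- swaps p, bikes down q - p
      obtain ⟨r, rfl⟩ := Nat.exists_eq_add_of_le h
      have := grid_bound (fun i j => f (d+i) (b'+(p+r)-i-j)) p r
        (fun i j _ _ => by
          obtain ⟨k, hk⟩ : ∃ k, b'+(p+r) = k + 2 + i + j := ⟨b'+(p+r) - (2+i+j), by omega⟩
          have e1 := m2 (d+i) k; have e3 := m3 (d+i) k
          have w0 : b'+(p+r)-i-j = k+2 := by omega
          have w1 : b'+(p+r)-(i+1)-j = k+1 := by omega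
          have w2 : b'+(p+r)-(i+2)-j = k := by omega
          simp only [w0, w1, w2]; simp only [← add_assoc] at *; linarith)
        (fun i j _ _ => by
          obtain ⟨k, hk⟩ : ∃ k, b'+(p+r) = k + 2 + i + j := ⟨b'+(p+r) - (2+i+j), by omega⟩
          have e1 := m1 (d+i) k; have e3 := m2 (d+i) k
          have w0 : b'+(p+r)-i-j = k+2 := by omega
          have w1 : b'+(p+r)-i-(j+1) = k+1 := by omega
          have w2 : b'+(p+r)-i-(j+2) = k := by omega
          simp only [w0, w1, w2]; simp only [← add_assoc] at *; linarith)
        (fun i j _ _ => by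
          obtain ⟨k, hk⟩ : ∃ k, b'+(p+r) = k + 2 + i + j := ⟨b'+(p+r) - (2+i+j), by omega⟩
          have e3 := m2 (d+i) k
          have w0 : b'+(p+r)-i-j = k+2 := by omega
          have w1 : b'+(p+r)-i-(j+1) = k+1 := by omega
          have w2 : b'+(p+r)-(i+1)-j = k+1 := by omega
          have w3 : b'+(p+r)-(i+1)-(j+1) = k := by omega
          simp only [w0, w1, w2, w3]; simp only [← add_assoc] at *; linarith)
      have z3 : b' + (p + r) - p - r = b' := by omega
      have z4 : p - (p + r) = 0 := by omega
      simp [z1, z2, z3, z4] at this ⊢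
      linarith
    · obtain ⟨r, rfl⟩ := Nat.exists_eq_add_of_le h
      have := grid_bound (fun i j => f (d+i+j) (b'+q-i)) q r
        (fun i j _ _ => by
          obtain ⟨k, hk⟩ : ∃ k, b'+q = k + 2 + i := ⟨b'+q - (2+i), by omega⟩
          have e1 := m2 (d+i+j) k; have e3 := m3 (d+i+j) k
          have w0 : b'+q-i = k+2 := by omega
          have w1 : b'+q-(i+1) = k+1 := by omega
          have w2 : b'+q-(i+2) = k := by omega
          have v1 : d+(i+1)+j = d+i+j+1 := by omega
          have v2 : d+(i+2)+j = d+i+j+2 := by omega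
          simp only [w0, w1, w2, v1, v2] at *; linarith)
        (fun i j _ _ => by
          have e1 := m1 (d+i+j) (b'+q-i); have e3 := m3 (d+i+j) (b'+q-i)
          simp only [← add_assoc] at *; linarith)
        (fun i j _ _ => by
          obtain ⟨k, hk⟩ : ∃ k, b'+q = k + 1 + i := ⟨b'+q - (1+i), by omega⟩
          have e3 := m3 (d+i+j) k
          have w0 : b'+q-i = k+1 := by omega
          have w1 : b'+q-(i+1) = k := by omega
          have v1 : d+(i+1)+j = d+i+j+1 := by omega
          have v2 : d+(i+1)+(j+1) = d+i+j+2 := by omega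
          have v3 : d+i+(j+1) = d+i+j+1 := by omega
          simp only [w0, w1, v1, v2, v3] at *; linarith)
      have z3 : q - (q + r) = 0 := by omega
      simp only [add_assoc] at this
      simp [z1, z2, z3] at this ⊢
      linarith
  · obtain ⟨p, rfl⟩ := Nat.exists_eq_add_of_le hd
    obtain ⟨q, rfl⟩ := Nat.exists_eq_add_of_le hb
    have z1 : d' - (d' + p) = 0 := by omega
    have z2 : b - (b + q) = 0 := by omega
    rcases le_total p q with h | h
    · -- swaps p, bikes up
      obtain ⟨r, rfl⟩ := Nat.exists_eq_add_of_le h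
      have := grid_bound (fun i j => f (d'+p-i) (b+i+j)) p r
        (fun i j _ _ => by
          obtain ⟨k, hk⟩ : ∃ k, d'+p = k + 2 + i := ⟨d'+p - (2+i), by omega⟩
          have e1 := m2 k (b+i+j); have e3 := m3 k (b+i+j)
          have w0 : d'+p-i = k+2 := by omega
          have w1 : d'+p-(i+1) = k+1 := by omega
          have w2 : d'+p-(i+2) = k := by omega
          have v1 : b+(i+1)+j = b+i+j+1 := by omega
          have v2 : b+(i+2)+j = b+i+j+2 := by omega
          simp only [w0, w1, w2, v1, v2] at *; linarith)
        (fun i j _ _ => by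
          have e1 := m1 (d'+p-i) (b+i+j); have e3 := m2 (d'+p-i) (b+i+j)
          simp only [← add_assoc] at *; linarith)
        (fun i j _ _ => by
          obtain ⟨k, hk⟩ : ∃ k, d'+p = k + 1 + i := ⟨d'+p - (1+i), by omega⟩
          have e3 := m2 k (b+i+j)
          have w0 : d'+p-i = k+1 := by omega
          have w1 : d'+p-(i+1) = k := by omega
          have v1 : b+(i+1)+j = b+i+j+1 := by omega
          have v2 : b+(i+1)+(j+1) = b+i+j+2 := by omega
          have v3 : b+i+(j+1) = b+i+j+1 := by omega
          simp only [w0, w1, v1, v2, v3] at *; linarith)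
      have z3 : p - (p + r) = 0 := by omega
      simp only [add_assoc] at this
      simp [z1, z2, z3] at this ⊢
      linarith
    · obtain ⟨r, rfl⟩ := Nat.exists_eq_add_of_le h
      have := grid_bound (fun i j => f (d'+(q+r)-i-j) (b+i)) q r
        (fun i j _ _ => by
          obtain ⟨k, hk⟩ : ∃ k, d'+(q+r) = k + 2 + i + j := ⟨d'+(q+r) - (2+i+j), by omega⟩
          have e1 := m2 k (b+i); have e3 := m3 k (b+i)
          have w0 : d'+(q+r)-i-j = k+2 := by omega
          have w1 : d'+(q+r)-(i+1)-j = k+1 := by omega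
          have w2 : d'+(q+r)-(i+2)-j = k := by omega
          simp only [w0, w1, w2]; simp only [← add_assoc] at *; linarith)
        (fun i j _ _ => by
          obtain ⟨k, hk⟩ : ∃ k, d'+(q+r) = k + 2 + i + j := ⟨d'+(q+r) - (2+i+j), by omega⟩
          have e1 := m1 k (b+i); have e3 := m3 k (b+i)
          have w0 : d'+(q+r)-i-j = k+2 := by omega
          have w1 : d'+(q+r)-i-(j+1) = k+1 := by omega
          have w2 : d'+(q+r)-i-(j+2) = k := by omega
          simp only [w0, w1, w2]; simp only [← add_assoc] at *; linarith)
        (fun i j _ _ => by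
          obtain ⟨k, hk⟩ : ∃ k, d'+(q+r) = k + 2 + i + j := ⟨d'+(q+r) - (2+i+j), by omega⟩
          have e3 := m3 k (b+i)
          have w0 : d'+(q+r)-i-j = k+2 := by omega
          have w1 : d'+(q+r)-i-(j+1) = k+1 := by omega
          have w2 : d'+(q+r)-(i+1)-j = k+1 := by omega
          have w3 : d'+(q+r)-(i+1)-(j+1) = k := by omega
          simp only [w0, w1, w2, w3]; simp only [← add_assoc] at *; linarith)
      have z3 : d' + (q + r) - q - r = d' := by omega
      have z4 : q - (q + r) = 0 := by omega
      simp [z1, z2, z3, z4] at this ⊢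
      linarith
  · obtain ⟨p, rfl⟩ := Nat.exists_eq_add_of_le hd
    obtain ⟨q, rfl⟩ := Nat.exists_eq_add_of_le hb
    have := grid_bound (fun i j => f (d'+p-i) (b'+q-j)) p q
      (fun i j _ _ => by
        obtain ⟨k, hk⟩ : ∃ k, d'+p = k + 2 + i := ⟨d'+p - (2+i), by omega⟩
        have e1 := m1 k (b'+q-j); have e3 := m3 k (b'+q-j)
        have w0 : d'+p-i = k+2 := by omega
        have w1 : d'+p-(i+1) = k+1 := by omega
        have w2 : d'+p-(i+2) = k := by omega
        simp only [w0, w1, w2] at *; linarith)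
      (fun i j _ _ => by
        obtain ⟨k, hk⟩ : ∃ k, b'+q = k + 2 + j := ⟨b'+q - (2+j), by omega⟩
        have e1 := m1 (d'+p-i) k; have e3 := m2 (d'+p-i) k
        have w0 : b'+q-j = k+2 := by omega
        have w1 : b'+q-(j+1) = k+1 := by omega
        have w2 : b'+q-(j+2) = k := by omega
        simp only [w0, w1, w2] at *; linarith)
      (fun i j _ _ => by
        obtain ⟨k, hk⟩ : ∃ k, d'+p = k + 1 + i := ⟨d'+p - (1+i), by omega⟩
        obtain ⟨l, hl⟩ : ∃ k, b'+q = k + 1 + j := ⟨b'+q - (1+j), by omega⟩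
        have e1 := m1 k l
        have w0 : d'+p-i = k+1 := by omega
        have w1 : d'+p-(i+1) = k := by omega
        have v0 : b'+q-j = l+1 := by omega
        have v1 : b'+q-(j+1) = l := by omega
        simp only [w0, w1, v0, v1] at *; linarith)
    have z1 : d' - (d' + p) = 0 := by omega
    have z2 : b' - (b' + q) = 0 := by omega
    simp [z1, z2] at this ⊢
    linarith

/-- Lower bound a weighted sum by total weight times a minimal attained value. -/
lemma weighted_min {n : ℕ} (k : Fin n → ℕ) (g : Fin n → ℝ) :
    ∃ m : ℝ, ((∑ i, k i : ℕ) : ℝ) * m ≤ ∑ i, (k i : ℝ) * g i ∧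
      (0 < ∑ i, k i → ∃ i, 0 < k i ∧ g i = m) := by
  by_cases h : ∃ i, 0 < k i
  · obtain ⟨i, hi⟩ := h
    obtain ⟨i0, h0, hmin⟩ := Finset.exists_min_image
      (Finset.univ.filter (fun i => 0 < k i)) g ⟨i, by simpa using hi⟩
    refine ⟨g i0, ?_, fun _ => ⟨i0, by simpa using h0, rfl⟩⟩
    push_cast
    rw [Finset.sum_mul]
    apply Finset.sum_le_sum
    intro j _
    rcases Nat.eq_zero_or_pos (k j) with hj | hj
    · simp [hj]
    · exact mul_le_mul_of_nonneg_left (hmin j (by simpa using hj)) (by positivity)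
  · push Not at h
    have : ∀ i, k i = 0 := fun i => by have := h i; omega
    exact ⟨0, by simp [this], by simp [this]⟩

/-- Arithmetic of grouping unit changes. -/
lemma grouping (Dp Dm Bp Bm Sp Sm : ℕ) (dp dm bp bm sp sm : ℝ)
    (e1 : Dp + Bp = Dm + Bm) (e2 : Bp + Sp = Bm + Sm)
    (h1 : 0 < Dp → 0 < Dm → 0 ≤ dm + dp)
    (h2 : 0 < Bp → 0 < Bm → 0 ≤ bm + bp)
    (h3 : 0 < Sp → 0 < Sm → 0 ≤ sp + sm)
    (h4 : 0 < Dm → 0 < Bp → 0 < Sm → 0 ≤ dm + bp + sm)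
    (h5 : 0 < Bm → 0 < Dp → 0 < Sp → 0 ≤ bm + dp + sp) :
    0 ≤ Dp * dp + Dm * dm + Bp * bp + Bm * bm + Sp * sp + Sm * sm := by
  have key : ∀ (k : ℕ) (x : ℝ), (0 < k → 0 ≤ x) → 0 ≤ (k : ℝ) * x := by
    intro k x h
    rcases Nat.eq_zero_or_pos k with hk | hk
    · simp [hk]
    · have := h hk; positivity
  rcases le_total Dm Dp with h | h
  · obtain ⟨p, rfl⟩ := Nat.exists_eq_add_of_le h
    obtain rfl : Bm = Bp + p := by omega
    obtain rfl : Sp = Sm + p := by omega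
    have a1 := key Dm (dm + dp) (fun _ => h1 (by omega) (by omega))
    have a2 := key Bp (bm + bp) (fun _ => h2 (by omega) (by omega))
    have a3 := key Sm (sp + sm) (fun _ => h3 (by omega) (by omega))
    have a4 := key p (bm + dp + sp) (fun _ => h5 (by omega) (by omega) (by omega))
    push_cast
    linarith
  · obtain ⟨p, rfl⟩ := Nat.exists_eq_add_of_le h
    obtain rfl : Bp = Bm + p := by omega
    obtain rfl : Sm = Sp + p := by omega
    have a1 := key Dp (dm + dp) (fun _ => h1 (by omega) (by omega))
    have a2 := key Bm (bm + bp) (fun _ => h2 (by omega) (by omega))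
    have a3 := key Sp (sp + sm) (fun _ => h3 (by omega) (by omega))
    have a4 := key p (dm + bp + sm) (fun _ => h4 (by omega) (by omega) (by omega))
    push_cast
    linarith

lemma obj_two {n : ℕ} (c : Fin n → ℕ → ℕ → ℝ) (a a' : Alloc n) (i j : Fin n) (x y : ℝ)
    (h : ∀ k, c k (a'.1 k) (a'.2 k) = c k (a.1 k) (a.2 k)
      + (if k = i then x else 0) + (if k = j then y else 0)) :
    obj c a' = obj c a + x + y := by
  unfold obj
  simp [h, Finset.sum_add_distrib]

lemma obj_three {n : ℕ} (c : Fin n → ℕ → ℕ → ℝ) (a a' : Alloc n) (i j l : Fin n) (x y z : ℝ)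
    (h : ∀ k, c k (a'.1 k) (a'.2 k) = c k (a.1 k) (a.2 k)
      + (if k = i then x else 0) + (if k = j then y else 0) + (if k = l then z else 0)) :
    obj c a' = obj c a + x + y + z := by
  unfold obj
  simp [h, Finset.sum_add_distrib]

lemma dist_lt {n : ℕ} (a a' s : Alloc n) (i j : Fin n)
    (h : ∀ k, ((a'.1 k + a'.2 k : ℤ) - (s.1 k + s.2 k : ℤ)).natAbs
      + (if k = i then 1 else 0) + (if k = j then 1 else 0) =
      ((a.1 k + a.2 k : ℤ) - (s.1 k + s.2 k : ℤ)).natAbs) :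
    dockDist a' s < dockDist a s := by
  unfold dockDist
  simp only [← h, Finset.sum_add_distrib, Finset.sum_ite_eq', Finset.mem_univ, if_true]
  omega

/-- If `a` is bike-optimal and some allocation `a⋆` with the same totals has strictly
smaller objective, then some single dock-move from `a` strictly reduces the objective
and strictly reduces the dock-move distance to `a⋆`. -/
theorem improving_dock_move_exists {n : ℕ} (c : Fin n → ℕ → ℕ → ℝ)
    (hc : ∀ i, Multimodular (c i)) (a astar : Alloc n) (hopt : BikeOptimal c a)
    (hcap : ∑ i, (astar.1 i + astar.2 i) = ∑ i, (a.1 i + a.2 i))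
    (hbike : ∑ i, astar.2 i = ∑ i, a.2 i)
    (hlt : obj c astar < obj c a) :
    ∃ a' ∈ Neighborhood a,
      obj c a' < obj c a ∧ dockDist a' astar < dockDist a astar := by
  by_contra hno
  push Not at hno
  have hno' : ∀ i j a', a' ∈ MoveFromTo a i j → dockDist a' astar < dockDist a astar →
      obj c a ≤ obj c a' := by
    intro i j a' hm hd
    by_contra hcon
    push Not at hcon
    have := hno a' (Set.mem_iUnion.2 ⟨i, Set.mem_iUnion.2 ⟨j, hm⟩⟩) hcon
    omega
  obtain ⟨d, b⟩ := a
  obtain ⟨d', b'⟩ := astar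
  try simp only at hcap hbike
  obtain ⟨mdp, hdp, wdp⟩ := weighted_min (fun i => (d' i - d i) - (b i - b' i))
    (fun i => c i (d i + 1) (b i) - c i (d i) (b i))
  obtain ⟨mdm, hdm, wdm⟩ := weighted_min (fun i => (d i - d' i) - (b' i - b i))
    (fun i => c i (d i - 1) (b i) - c i (d i) (b i))
  obtain ⟨mbp, hbp, wbp⟩ := weighted_min (fun i => (b' i - b i) - (d i - d' i))
    (fun i => c i (d i) (b i + 1) - c i (d i) (b i))
  obtain ⟨mbm, hbm, wbm⟩ := weighted_min (fun i => (b i - b' i) - (d' i - d i))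
    (fun i => c i (d i) (b i - 1) - c i (d i) (b i))
  obtain ⟨msp, hsp, wsp⟩ := weighted_min (fun i => min (d i - d' i) (b' i - b i))
    (fun i => c i (d i - 1) (b i + 1) - c i (d i) (b i))
  obtain ⟨msm, hsm, wsm⟩ := weighted_min (fun i => min (d' i - d i) (b i - b' i))
    (fun i => c i (d i + 1) (b i - 1) - c i (d i) (b i))
  try simp only at wdp wdm wbp wbm wsp wsm
  have htot := Finset.sum_le_sum (s := Finset.univ)
    (fun i _ => station_bound (c i) (hc i) (d i) (b i) (d' i) (b' i))
  have hobj : ∑ i, (c i (d' i) (b' i) - c i (d i) (b i)) = obj c (d', b') - obj c (d, b) := by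
    unfold obj
    rw [← Finset.sum_sub_distrib]
  rw [hobj] at htot
  simp only [Finset.sum_add_distrib] at htot
  have hg := grouping (dp := mdp) (dm := mdm) (bp := mbp) (bm := mbm) (sp := msp) (sm := msm)
    (Dp := ∑ i, ((d' i - d i) - (b i - b' i))) (Dm := ∑ i, ((d i - d' i) - (b' i - b i)))
    (Bp := ∑ i, ((b' i - b i) - (d i - d' i))) (Bm := ∑ i, ((b i - b' i) - (d' i - d i)))
    (Sp := ∑ i, min (d i - d' i) (b' i - b i)) (Sm := ∑ i, min (d' i - d i) (b i - b' i))
    ?_ ?_ ?_ ?_ ?_ ?_ ?_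
  · linarith
  · have : ∑ i, (((d' i - d i) - (b i - b' i)) + ((b' i - b i) - (d i - d' i)) + (d i + b i))
        = ∑ i, (((d i - d' i) - (b' i - b i)) + ((b i - b' i) - (d' i - d i)) + (d' i + b' i)) :=
      Finset.sum_congr rfl (fun i _ => by omega)
    rw [Finset.sum_add_distrib, Finset.sum_add_distrib, Finset.sum_add_distrib (g := fun i => d' i + b' i),
      Finset.sum_add_distrib (f := fun i => (d i - d' i) - (b' i - b i))] at this
    omega
  · have : ∑ i, (((b' i - b i) - (d i - d' i)) + min (d i - d' i) (b' i - b i) + b i)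
        = ∑ i, (((b i - b' i) - (d' i - d i)) + min (d' i - d i) (b i - b' i) + b' i) :=
      Finset.sum_congr rfl (fun i _ => by omega)
    rw [Finset.sum_add_distrib, Finset.sum_add_distrib, Finset.sum_add_distrib (g := fun i => b' i),
      Finset.sum_add_distrib (f := fun i => (b i - b' i) - (d' i - d i))] at this
    omega
  · intro p1 p2
    obtain ⟨j, hj, ej⟩ := wdp p1
    obtain ⟨i, hi, ei⟩ := wdm p2
    have hij : i ≠ j := by rintro rfl; omega
    have h := hno' i j _ (Or.inl ⟨by simp only; omega, rfl⟩) (dist_lt _ _ _ i j (by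
      intro k
      simp only [moveOne]
      by_cases ki : k = i
      · subst ki; simp [hij]; omega
      · by_cases kj : k = j
        · subst kj; simp [ki]; omega
        · simp [ki, kj]))
    rw [obj_two c (d, b) (moveOne d i j, b) i j mdm mdp (by
      intro k
      simp only [moveOne]
      by_cases ki : k = i
      · subst ki; simp [hij, ← ei]
      · by_cases kj : k = j
        · subst kj; simp [ki, ← ej]
        · simp [ki, kj])] at h
    linarith
  · intro p1 p2
    obtain ⟨j, hj, ej⟩ := wbp p1
    obtain ⟨i, hi, ei⟩ := wbm p2
    have hij : i ≠ j := by rintro rfl; omega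
    have h := hno' i j _ (Or.inr (Or.inl ⟨by simp only; omega, rfl⟩)) (dist_lt _ _ _ i j (by
      intro k
      simp only [moveOne]
      by_cases ki : k = i
      · subst ki; simp [hij]; omega
      · by_cases kj : k = j
        · subst kj; simp [ki]; omega
        · simp [ki, kj]))
    rw [obj_two c (d, b) (d, moveOne b i j) i j mbm mbp (by
      intro k
      simp only [moveOne]
      by_cases ki : k = i
      · subst ki; simp [hij, ← ei]
      · by_cases kj : k = j
        · subst kj; simp [ki, ← ej]
        · simp [ki, kj])] at h
    linarith
  · intro p1 p2
    obtain ⟨i, hi, ei⟩ := wsp p1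
    obtain ⟨j, hj, ej⟩ := wsm p2
    have hij : i ≠ j := by rintro rfl; omega
    have h := hopt (moveOne d i j, moveOne b j i) (by
      intro k
      simp only [moveOne]
      by_cases ki : k = i
      · subst ki; simp [hij]; omega
      · by_cases kj : k = j
        · subst kj; simp [ki]; omega
        · simp [ki, kj]) (by
      have : ∑ k, (moveOne b j i k + if k = j then 1 else 0)
          = ∑ k, (b k + if k = i then 1 else 0) := by
        refine Finset.sum_congr rfl (fun k _ => ?_)
        simp only [moveOne]
        by_cases kj : k = j
        · subst kj; simp [hij.symm]; omega
        · simp [kj]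
      simp only [Finset.sum_add_distrib, Finset.sum_ite_eq', Finset.mem_univ, if_true] at this
      simp only
      omega)
    rw [obj_two c (d, b) (moveOne d i j, moveOne b j i) i j msp msm (by
      intro k
      simp only [moveOne]
      by_cases ki : k = i
      · subst ki; simp [hij, ← ei]
      · by_cases kj : k = j
        · subst kj; simp [ki, ← ej]
        · simp [ki, kj])] at h
    linarith
  · intro p1 p2 p3
    obtain ⟨i, hi, ei⟩ := wdm p1
    obtain ⟨j, hj, ej⟩ := wbp p2
    obtain ⟨l, hl, el⟩ := wsm p3
    have hil : i ≠ l := by rintro rfl; omega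
    have hjl : j ≠ l := by rintro rfl; omega
    have hij : i ≠ j := by rintro rfl; omega
    have h := hno' i j _ (Or.inr (Or.inr (Or.inl ⟨l, by simp only; omega, by simp only; omega, rfl⟩)))
      (dist_lt _ _ _ i j (by
      intro k
      simp only [moveOne]
      by_cases ki : k = i
      · subst ki; simp [hij, hil]; omega
      · by_cases kj : k = j
        · subst kj; simp [ki, hjl]; omega
        · by_cases kl : k = l
          · subst kl; simp [ki, kj]; omega
          · simp [ki, kj, kl]))
    rw [obj_three c (d, b) (moveOne d i l, moveOne b l j) i j l mdm mbp msm (by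
      intro k
      simp only [moveOne]
      by_cases ki : k = i
      · subst ki; simp [hij, hil, ← ei]
      · by_cases kj : k = j
        · subst kj; simp [ki, hjl, ← ej]
        · by_cases kl : k = l
          · subst kl; simp [ki, kj, ← el]
          · simp [ki, kj, kl])] at h
    linarith
  · intro p1 p2 p3
    obtain ⟨i, hi, ei⟩ := wbm p1
    obtain ⟨j, hj, ej⟩ := wdp p2
    obtain ⟨l, hl, el⟩ := wsp p3
    have hil : i ≠ l := by rintro rfl; omega
    have hjl : j ≠ l := by rintro rfl; omega
    have hij : i ≠ j := by rintro rfl; omega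
    have h := hno' i j _ (Or.inr (Or.inr (Or.inr ⟨l, by simp only; omega, by simp only; omega, rfl⟩)))
      (dist_lt _ _ _ i j (by
      intro k
      simp only [moveOne]
      by_cases ki : k = i
      · subst ki; simp [hij, hil]; omega
      · by_cases kj : k = j
        · subst kj; simp [ki, hjl]; omega
        · by_cases kl : k = l
          · subst kl; simp [ki, kj]; omega
          · simp [ki, kj, kl]))
    rw [obj_three c (d, b) (moveOne d l j, moveOne b i l) i j l mbm mdp msp (by
      intro k
      simp only [moveOne]
      by_cases ki : k = i
      · subst ki; simp [hij, hil, ← ei]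
      · by_cases kj : k = j
        · subst kj; simp [ki, hjl, ← ej]
        · by_cases kl : k = l
          · subst kl; simp [ki, kj, ← el]
          · simp [ki, kj, kl])] at h
    linarith
end

section
/- Let (d⃗,b⃗) be a bike-optimal allocation. Suppose (d⃗^z,b⃗^z) minimizes the objective c over S_z(d⃗,b⃗), and let (d⃗^{z+1},b⃗^{z+1}) be a minimizer of c over the neighborhood N(d⃗^z,b⃗^z). Then (d⃗^{z+1},b⃗^{z+1}) is a local optimum within S_{z+1}(d⃗,b⃗): no allocation in N(d⃗^{z+1},b⃗^{z+1}) ∩ S_{z+1}(d⃗,b⃗) has strictly smaller objective. -/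
/-- Conformal one-step exchange data at one station. -/
def SConf (d b d' b' p q p' q' : ℕ) : Prop :=
  p + p' = d + d' ∧ q + q' = b + b' ∧
  ((p = d ∧ q = b) ∨
   (p = d + 1 ∧ q = b ∧ d < d' ∧ d + b < d' + b') ∨
   (d = p + 1 ∧ q = b ∧ d' < d ∧ d' + b' < d + b) ∨
   (p = d ∧ q = b + 1 ∧ b < b' ∧ d + b < d' + b') ∨
   (p = d ∧ b = q + 1 ∧ b' < b ∧ d' + b' < d + b) ∨
   (p = d + 1 ∧ b = q + 1 ∧ d < d' ∧ b' < b) ∨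
   (d = p + 1 ∧ q = b + 1 ∧ d' < d ∧ b < b'))

theorem inc_d {f : ℕ → ℕ → ℝ} (h1 : ∀ d b : ℕ, f (d+1) (b+1) - f (d+1) b ≥ f d (b+1) - f d b)
    (h3 : ∀ d b : ℕ, f (d+2) b - f (d+1) b ≥ f (d+1) (b+1) - f d (b+1))
    (d b d' b' : ℕ) (hd : d ≤ d') (hD : d + b ≤ d' + b') :
    f (d+1) b - f d b ≤ f (d'+1) b' - f d' b' := by
  have hb : ∀ k d b, f (d+1) b - f d b ≤ f (d+1) (b+k) - f d (b+k) := by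
    intro k
    induction k with
    | zero => intro d b; simp
    | succ k ih =>
      intro d b
      have := ih d b
      have := h1 d (b+k)
      rw [← add_assoc]; linarith
  have hdd : ∀ k d b, f (d+1) b - f d b ≤ f (d+k+1) b - f (d+k) b := by
    intro k
    induction k with
    | zero => intro d b; simp
    | succ k ih =>
      intro d b
      have := ih d b
      have := h1 (d+k) b
      have := h3 (d+k) b
      have e : d + (k+1) = d + k + 1 := by omega
      rw [e]
      have e : d + k + 1 + 1 = d + k + 2 := by omega
      rw [e]
      linarith
  have hx : ∀ k d b, f (d+1) (b+k) - f d (b+k) ≤ f (d+k+1) b - f (d+k) b := by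
    intro k
    induction k with
    | zero => intro d b; simp
    | succ k ih =>
      intro d b
      have := ih d (b+1)
      have := h3 (d+k) b
      have e : d + (k+1) = d + k + 1 := by omega
      rw [e]
      have e : d + k + 1 + 1 = d + k + 2 := by omega
      rw [e]
      have e : b + (k+1) = b + 1 + k := by omega
      rw [e]
      linarith
  rcases le_total b b' with h | h
  · obtain ⟨k, rfl⟩ := Nat.exists_eq_add_of_le h
    obtain ⟨m, rfl⟩ := Nat.exists_eq_add_of_le hd
    exact (hb k d b).trans (hdd m d (b+k))
  · obtain ⟨k, rfl⟩ := Nat.exists_eq_add_of_le h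
    obtain ⟨m, rfl⟩ : ∃ m, d' = d + k + m := ⟨d' - (d+k), by omega⟩
    exact (hx k d b').trans (hdd m (d+k) b')

theorem inc_x {f : ℕ → ℕ → ℝ} (hf : Multimodular f)
    (d b d' b' : ℕ) (hd : d ≤ d') (hb : b' ≤ b) :
    f (d+1) b - f d (b+1) ≤ f (d'+1) b' - f d' (b'+1) := by
  obtain ⟨h1, h2, h3⟩ := hf
  have hA : ∀ k d b, f (d+1) b - f d (b+1) ≤ f (d+k+1) b - f (d+k) (b+1) := by
    intro k
    induction k with
    | zero => intro d b; simp
    | succ k ih =>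
      intro d b
      have := ih d b
      have := h3 (d+k) b
      have e : d + (k+1) = d + k + 1 := by omega
      rw [e]
      have e : d + k + 1 + 1 = d + k + 2 := by omega
      rw [e]
      linarith
  have hB : ∀ k d b, f (d+1) (b+k) - f d (b+k+1) ≤ f (d+1) b - f d (b+1) := by
    intro k
    induction k with
    | zero => intro d b; simp
    | succ k ih =>
      intro d b
      have := ih d b
      have := h2 d (b+k)
      have e : b + (k+1) = b + k + 1 := by omega
      rw [e]
      have e : b + k + 1 + 1 = b + k + 2 := by omega
      rw [e]
      linarith
  obtain ⟨k, rfl⟩ := Nat.exists_eq_add_of_le hd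
  obtain ⟨m, rfl⟩ := Nat.exists_eq_add_of_le hb
  exact (hB m d b').trans (hA k d b')

theorem ex_d {f : ℕ → ℕ → ℝ} (hf : Multimodular f)
    {d b d' b' p : ℕ} (hp : d' = p + 1) (h : d < d') (hD : d + b < d' + b') :
    f (d+1) b + f p b' ≤ f d b + f d' b' := by
  subst hp
  have := inc_d hf.1 hf.2.2 d b p b' (by omega) (by omega)
  linarith

theorem ex_b {f : ℕ → ℕ → ℝ} (hf : Multimodular f)
    {d b d' b' q : ℕ} (hq : b' = q + 1) (h : b < b') (hD : d + b < d' + b') :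
    f d (b+1) + f d' q ≤ f d b + f d' b' := by
  subst hq
  have := inc_d (f := fun x y => f y x)
    (fun x y => by have := hf.1 y x; simp only [ge_iff_le] at *; linarith)
    (fun x y => by have := hf.2.1 y x; simp only [ge_iff_le] at *; linarith)
    b d q d' (by omega) (by omega)
  linarith

theorem ex_x {f : ℕ → ℕ → ℝ} (hf : Multimodular f)
    {d b d' b' p q : ℕ} (hp : d' = p + 1) (hq : b = q + 1) (h : d < d') (hb : b' < b) :
    f (d+1) q + f p (b'+1) ≤ f d b + f d' b' := by
  subst hp hq
  have := inc_x hf d q p b' (by omega) (by omega)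
  linarith

theorem station {f : ℕ → ℕ → ℝ} (hf : Multimodular f) {d b d' b' p q p' q' : ℕ}
    (h : SConf d b d' b' p q p' q') : f p q + f p' q' ≤ f d b + f d' b' := by
  obtain ⟨hd, hb, h⟩ := h
  rcases h with ⟨h1, h2⟩ | ⟨h1, h2, h3, h4⟩ | ⟨h1, h2, h3, h4⟩ | ⟨h1, h2, h3, h4⟩ |
    ⟨h1, h2, h3, h4⟩ | ⟨h1, h2, h3, h4⟩ | ⟨h1, h2, h3, h4⟩
  · obtain rfl : p' = d' := by omega
    obtain rfl : q' = b' := by omega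
    subst h1 h2; exact le_rfl
  · obtain rfl : q' = b' := by omega
    subst h1 h2
    exact ex_d hf (by omega) h3 h4
  · obtain rfl : q' = b' := by omega
    obtain rfl : p' = d' + 1 := by omega
    subst h2
    have := ex_d hf h1 h3 h4
    linarith
  · obtain rfl : p' = d' := by omega
    subst h1 h2
    exact ex_b hf (by omega) h3 h4
  · obtain rfl : p' = d' := by omega
    obtain rfl : q' = b' + 1 := by omega
    subst h1
    have := ex_b hf h2 h3 h4
    linarith
  · obtain rfl : q' = b' + 1 := by omega
    subst h1
    exact ex_x hf (by omega) h2 h3 h4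
  · obtain rfl : p' = d' + 1 := by omega
    subst h2
    have := ex_x (q := q') hf h1 (by omega) h3 h4
    linarith

theorem obj_exchange {n : ℕ} {c : Fin n → ℕ → ℕ → ℝ} (hc : ∀ i, Multimodular (c i))
    {x w u v : Alloc n}
    (h : ∀ k, SConf (x.1 k) (x.2 k) (w.1 k) (w.2 k) (u.1 k) (u.2 k) (v.1 k) (v.2 k)) :
    obj c u + obj c v ≤ obj c x + obj c w := by
  unfold obj
  rw [← Finset.sum_add_distrib, ← Finset.sum_add_distrib]
  exact Finset.sum_le_sum fun k _ => station (hc k) (h k)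

/-- Same number of open docks and bikes. -/
def SameTot {n : ℕ} (x y : Alloc n) : Prop :=
  ∑ i, x.1 i = ∑ i, y.1 i ∧ ∑ i, x.2 i = ∑ i, y.2 i

theorem moveOne_add {n : ℕ} (v : Fin n → ℕ) {i : Fin n} (j : Fin n) (hi : 1 ≤ v i) (k : Fin n) :
    moveOne v i j k + (if k = i then 1 else 0) = v k + (if k = j then 1 else 0) := by
  unfold moveOne
  by_cases h : k = i
  · subst h; simp; omega
  · simp [h]

theorem sum_moveOne {n : ℕ} (v : Fin n → ℕ) {i : Fin n} (j : Fin n) (hi : 1 ≤ v i) :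
    ∑ k, moveOne v i j k = ∑ k, v k := by
  have := Finset.sum_congr rfl (fun k (_ : k ∈ Finset.univ) => moveOne_add v j hi k)
  simpa [Finset.sum_add_distrib] using this

theorem mem_nbhd {n : ℕ} {x u : Alloc n} (h : u ∈ Neighborhood x) :
    ∃ i j, u ∈ MoveFromTo x i j := by
  simpa [Neighborhood] using h

theorem nbhd_mem {n : ℕ} {x u : Alloc n} (i j : Fin n) (h : u ∈ MoveFromTo x i j) :
    u ∈ Neighborhood x := by
  simp only [Neighborhood, Set.mem_iUnion]
  exact ⟨i, j, h⟩

theorem move_props {n : ℕ} {x u : Alloc n} {i j : Fin n} (h : u ∈ MoveFromTo x i j) :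
    SameTot u x ∧ ∀ k, u.1 k + u.2 k + (if k = i then 1 else 0)
      = x.1 k + x.2 k + (if k = j then 1 else 0) := by
  rcases h with ⟨h1, rfl⟩ | ⟨h1, rfl⟩ | ⟨h, h1, h2, rfl⟩ | ⟨h, h1, h2, rfl⟩
  · refine ⟨⟨sum_moveOne _ _ h1, rfl⟩, fun k => ?_⟩
    have := moveOne_add x.1 j h1 k
    dsimp only; omega
  · refine ⟨⟨rfl, sum_moveOne _ _ h1⟩, fun k => ?_⟩
    have := moveOne_add x.2 j h1 k
    dsimp only; omega
  · refine ⟨⟨sum_moveOne _ _ h1, sum_moveOne _ _ h2⟩, fun k => ?_⟩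
    have := moveOne_add x.1 h h1 k
    have := moveOne_add x.2 j h2 k
    dsimp only; omega
  · refine ⟨⟨sum_moveOne _ _ h1, sum_moveOne _ _ h2⟩, fun k => ?_⟩
    have := moveOne_add x.1 j h1 k
    have := moveOne_add x.2 h h2 k
    dsimp only; omega

theorem exists_lt_of_sum {n : ℕ} {f g : Fin n → ℕ} (h : ∑ k, f k = ∑ k, g k) {i : Fin n}
    (hi : f i < g i) : ∃ j, g j < f j := by
  by_contra hcon
  push Not at hcon
  have := Finset.sum_lt_sum (fun k (_ : k ∈ Finset.univ) => hcon k) ⟨i, Finset.mem_univ i, hi⟩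
  omega

set_option maxHeartbeats 4000000 in
/-- A conformal dock-move towards station `i`. -/
theorem conformal_move {n : ℕ} {x w : Alloc n} (ht : SameTot x w) {i : Fin n}
    (hi : x.1 i + x.2 i < w.1 i + w.2 i) :
    ∃ l u v, w.1 l + w.2 l < x.1 l + x.2 l ∧ u ∈ MoveFromTo x l i ∧ v ∈ MoveFromTo w i l ∧
      ∀ k, SConf (x.1 k) (x.2 k) (w.1 k) (w.2 k) (u.1 k) (u.2 k) (v.1 k) (v.2 k) := by
  have hD : ∑ k, (x.1 k + x.2 k) = ∑ k, (w.1 k + w.2 k) := by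
    rw [Finset.sum_add_distrib, Finset.sum_add_distrib, ht.1, ht.2]
  by_cases hA : x.1 i < w.1 i ∧ ∃ l, w.1 l + w.2 l < x.1 l + x.2 l ∧ w.1 l < x.1 l
  · obtain ⟨h1, l, h2, h3⟩ := hA
    have hx : 1 ≤ x.1 l := by omega
    have hw : 1 ≤ w.1 i := by omega
    have hil : i ≠ l := by rintro rfl; omega
    refine ⟨l, (moveOne x.1 l i, x.2), (moveOne w.1 i l, w.2), h2, Or.inl ⟨hx, rfl⟩,
      Or.inl ⟨hw, rfl⟩, fun k => ?_⟩
    have e1 := moveOne_add x.1 i hx k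
    have e2 := moveOne_add w.1 l hw k
    unfold SConf
    dsimp only
    grind
  by_cases hB : x.2 i < w.2 i ∧ ∃ l, w.1 l + w.2 l < x.1 l + x.2 l ∧ w.2 l < x.2 l
  · obtain ⟨h1, l, h2, h3⟩ := hB
    have hx : 1 ≤ x.2 l := by omega
    have hw : 1 ≤ w.2 i := by omega
    have hil : i ≠ l := by rintro rfl; omega
    refine ⟨l, (x.1, moveOne x.2 l i), (w.1, moveOne w.2 i l), h2, Or.inr (Or.inl ⟨hx, rfl⟩),
      Or.inr (Or.inl ⟨hw, rfl⟩), fun k => ?_⟩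
    have e1 := moveOne_add x.2 i hx k
    have e2 := moveOne_add w.2 l hw k
    unfold SConf
    dsimp only
    grind
  push Not at hA hB
  obtain ⟨l, hl⟩ := exists_lt_of_sum hD hi
  by_cases hd : x.1 i < w.1 i
  · have hA := hA hd
    have hl1 := hA l hl
    obtain ⟨j, hj⟩ := exists_lt_of_sum ht.1 hd
    have hj2 : w.1 j + w.2 j ≥ x.1 j + x.2 j := by
      by_contra hcon
      have := hA j (by omega)
      omega
    have hxj : 1 ≤ x.1 j := by omega
    have hxl : 1 ≤ x.2 l := by omega
    have hwi : 1 ≤ w.1 i := by omega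
    have hwj : 1 ≤ w.2 j := by omega
    have n1 : i ≠ l := by rintro rfl; omega
    have n2 : j ≠ l := by rintro rfl; omega
    have n3 : i ≠ j := by rintro rfl; omega
    refine ⟨l, (moveOne x.1 j i, moveOne x.2 l j), (moveOne w.1 i j, moveOne w.2 j l), hl,
      Or.inr (Or.inr (Or.inr ⟨j, hxj, hxl, rfl⟩)),
      Or.inr (Or.inr (Or.inl ⟨j, hwi, hwj, rfl⟩)), fun k => ?_⟩
    have e1 := moveOne_add x.1 i hxj k
    have e2 := moveOne_add x.2 j hxl k
    have e3 := moveOne_add w.1 j hwi k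
    have e4 := moveOne_add w.2 l hwj k
    unfold SConf
    dsimp only
    by_cases k1 : k = i
    · subst k1; simp only [n1, n3, if_true, if_false] at e1 e2 e3 e4; omega
    by_cases k2 : k = l
    · subst k2; simp only [k1, n2.symm, if_true, if_false] at e1 e2 e3 e4; omega
    by_cases k3 : k = j
    · subst k3; simp only [k1, k2, if_true, if_false] at e1 e2 e3 e4; omega
    simp only [k1, k2, k3, if_false] at e1 e2 e3 e4; omega
  · have hb : x.2 i < w.2 i := by omega
    have hB := hB hb
    have hl1 := hB l hl
    obtain ⟨j, hj⟩ := exists_lt_of_sum ht.2 hb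
    have hj2 : w.1 j + w.2 j ≥ x.1 j + x.2 j := by
      by_contra hcon
      have := hB j (by omega)
      omega
    have hxj : 1 ≤ x.2 j := by omega
    have hxl : 1 ≤ x.1 l := by omega
    have hwi : 1 ≤ w.2 i := by omega
    have hwj : 1 ≤ w.1 j := by omega
    have n1 : i ≠ l := by rintro rfl; omega
    have n2 : j ≠ l := by rintro rfl; omega
    have n3 : i ≠ j := by rintro rfl; omega
    refine ⟨l, (moveOne x.1 l j, moveOne x.2 j i), (moveOne w.1 j l, moveOne w.2 i j), hl,
      Or.inr (Or.inr (Or.inl ⟨j, hxl, hxj, rfl⟩)),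
      Or.inr (Or.inr (Or.inr ⟨j, hwj, hwi, rfl⟩)), fun k => ?_⟩
    have e1 := moveOne_add x.2 i hxj k
    have e2 := moveOne_add x.1 j hxl k
    have e3 := moveOne_add w.2 j hwi k
    have e4 := moveOne_add w.1 l hwj k
    unfold SConf
    dsimp only
    by_cases k1 : k = i
    · subst k1; simp only [n1, n3, if_true, if_false] at e1 e2 e3 e4; omega
    by_cases k2 : k = l
    · subst k2; simp only [k1, n2.symm, if_true, if_false] at e1 e2 e3 e4; omega
    by_cases k3 : k = j
    · subst k3; simp only [k1, k2, if_true, if_false] at e1 e2 e3 e4; omega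
    simp only [k1, k2, k3, if_false] at e1 e2 e3 e4; omega

/-- Number of docks added relative to `a` (half the dock-move distance). -/
def excess {n : ℕ} (a w : Alloc n) : ℕ := ∑ k, ((w.1 k + w.2 k) - (a.1 k + a.2 k))

/-- The ball in terms of the dock-move distance. -/
def TBall {n : ℕ} (a : Alloc n) (z : ℕ) : Set (Alloc n) :=
  {w | SameTot w a ∧ excess a w ≤ z}

theorem sum_ind_le {n : ℕ} {f g : Fin n → ℕ} (i j : Fin n)
    (h : ∀ k, f k + (if k = i then 1 else 0) ≤ g k + (if k = j then 1 else 0)) :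
    ∑ k, f k ≤ ∑ k, g k := by
  have := Finset.sum_le_sum (fun k (_ : k ∈ Finset.univ) => h k)
  simpa [Finset.sum_add_distrib] using this

theorem sum_ind_lt {n : ℕ} {f g : Fin n → ℕ} (i : Fin n)
    (h : ∀ k, f k + (if k = i then 1 else 0) ≤ g k) :
    ∑ k, f k + 1 ≤ ∑ k, g k := by
  have := Finset.sum_le_sum (fun k (_ : k ∈ Finset.univ) => h k)
  simpa [Finset.sum_add_distrib] using this

theorem sum_ind_succ {n : ℕ} {f g : Fin n → ℕ} (i : Fin n)
    (h : ∀ k, f k ≤ g k + (if k = i then 1 else 0)) :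
    ∑ k, f k ≤ ∑ k, g k + 1 := by
  have := Finset.sum_le_sum (fun k (_ : k ∈ Finset.univ) => h k)
  simpa [Finset.sum_add_distrib] using this

theorem ball_sub_TBall {n : ℕ} (a : Alloc n) (z : ℕ) : ball a z ⊆ TBall a z := by
  induction z with
  | zero =>
    rintro w hw
    have : w = a := hw
    subst this
    exact ⟨⟨rfl, rfl⟩, by simp [excess]⟩
  | succ z ih =>
    rintro w (hw | hw)
    · exact ⟨(ih hw).1, (ih hw).2.trans (Nat.le_succ z)⟩
    · simp only [Set.mem_iUnion] at hw
      obtain ⟨y, hy, hw⟩ := hw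
      obtain ⟨i, j, hw⟩ := mem_nbhd hw
      obtain ⟨ht, hk⟩ := move_props hw
      obtain ⟨hyt, hye⟩ := ih hy
      refine ⟨⟨ht.1.trans hyt.1, ht.2.trans hyt.2⟩, ?_⟩
      have : excess a w ≤ excess a y + 1 := by
        refine sum_ind_succ j fun k => ?_
        have := hk k
        split_ifs at this ⊢ <;> omega
      omega

theorem exchange_s10 {n : ℕ} {c : Fin n → ℕ → ℕ → ℝ} (hc : ∀ i, Multimodular (c i))
    {a x : Alloc n} {z : ℕ} (hx : x ∈ TBall a z) (hmin : ∀ y ∈ TBall a z, obj c x ≤ obj c y) :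
    ∀ (m : ℕ) (w : Alloc n), w ∈ TBall a (z+1) →
      ∑ k, ((x.1 k + x.2 k) - (w.1 k + w.2 k)) ≤ m →
      obj c x ≤ obj c w ∨ ∃ u ∈ Neighborhood x, obj c u ≤ obj c w := by
  intro m
  induction m with
  | zero => 
    intro w hw hm
    by_cases hwz : excess a w ≤ z
    · exact Or.inl (hmin w ⟨hw.1, hwz⟩)
    exfalso
    obtain ⟨i, -, hi⟩ : ∃ i ∈ Finset.univ, (x.1 i + x.2 i) - (a.1 i + a.2 i)
        < (w.1 i + w.2 i) - (a.1 i + a.2 i) := by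
      apply Finset.exists_lt_of_sum_lt
      have := hx.2
      unfold excess at *
      omega
    obtain ⟨l, u, v, hl, -⟩ := conformal_move
      ⟨hx.1.1.trans hw.1.1.symm, hx.1.2.trans hw.1.2.symm⟩ (show x.1 i + x.2 i < w.1 i + w.2 i by omega)
    have := Finset.single_le_sum (f := fun k => (x.1 k + x.2 k) - (w.1 k + w.2 k))
      (fun k _ => Nat.zero_le _) (Finset.mem_univ l)
    omega
  | succ m ih =>
    intro w hw hm
    by_cases hwz : excess a w ≤ z
    · exact Or.inl (hmin w ⟨hw.1, hwz⟩)
    obtain ⟨i, -, hi⟩ : ∃ i ∈ Finset.univ, (x.1 i + x.2 i) - (a.1 i + a.2 i)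
        < (w.1 i + w.2 i) - (a.1 i + a.2 i) := by
      apply Finset.exists_lt_of_sum_lt
      have := hx.2
      unfold excess at *
      omega
    obtain ⟨l, u, v, hl, hu, hv, hconf⟩ := conformal_move
      ⟨hx.1.1.trans hw.1.1.symm, hx.1.2.trans hw.1.2.symm⟩ (show x.1 i + x.2 i < w.1 i + w.2 i by omega)
    have hobj := obj_exchange hc hconf
    obtain ⟨htu, hku⟩ := move_props hu
    obtain ⟨htv, hkv⟩ := move_props hv
    have hil : i ≠ l := by rintro rfl; omega
    by_cases hla : w.1 l + w.2 l < a.1 l + a.2 l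
    · right
      refine ⟨u, nbhd_mem _ _ hu, ?_⟩
      have hvT : v ∈ TBall a z := by
        refine ⟨⟨htv.1.trans hw.1.1, htv.2.trans hw.1.2⟩, ?_⟩
        have : excess a v + 1 ≤ excess a w := by
          refine sum_ind_lt i fun k => ?_
          have hk := hkv k
          by_cases k1 : k = i
          · subst k1; simp only [hil, if_true, if_false] at hk ⊢; omega
          by_cases k2 : k = l
          · subst k2; simp only [k1, if_true, if_false] at hk ⊢; omega
          simp only [k1, k2, if_false] at hk ⊢; omega
        have := hw.2
        omega
      have := hmin v hvT
      linarith
    · have huT : u ∈ TBall a z := by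
        refine ⟨⟨htu.1.trans hx.1.1, htu.2.trans hx.1.2⟩, ?_⟩
        refine le_trans (sum_ind_le l i fun k => ?_) hx.2
        have hk := hku k
        by_cases k1 : k = i
        · subst k1; simp only [hil, if_true, if_false] at hk ⊢; omega
        by_cases k2 : k = l
        · subst k2; simp only [k1, if_true, if_false] at hk ⊢; omega
        simp only [k1, k2, if_false] at hk ⊢; omega
      have hvT : v ∈ TBall a (z+1) := by
        refine ⟨⟨htv.1.trans hw.1.1, htv.2.trans hw.1.2⟩, ?_⟩
        refine le_trans (sum_ind_le i l fun k => ?_) hw.2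
        have hk := hkv k
        by_cases k1 : k = i
        · subst k1; simp only [hil, if_true, if_false] at hk ⊢; omega
        by_cases k2 : k = l
        · subst k2; simp only [k1, if_true, if_false] at hk ⊢; omega
        simp only [k1, k2, if_false] at hk ⊢; omega
      have hvm : ∑ k, ((x.1 k + x.2 k) - (v.1 k + v.2 k)) + 1
          ≤ ∑ k, ((x.1 k + x.2 k) - (w.1 k + w.2 k)) := by
        refine sum_ind_lt l fun k => ?_
        have hk := hkv k
        by_cases k1 : k = i
        · subst k1; simp only [hil, if_true, if_false] at hk ⊢; omega
        by_cases k2 : k = l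
        · subst k2; simp only [k1, if_true, if_false] at hk ⊢; omega
        simp only [k1, k2, if_false] at hk ⊢; omega
      have h1 := hmin u huT
      have h2 : obj c v ≤ obj c w := by linarith
      rcases ih v hvT (by omega) with h | ⟨u', hu', h⟩
      · exact Or.inl (h.trans h2)
      · exact Or.inr ⟨u', hu', h.trans h2⟩

theorem TBall_finite {n : ℕ} (a : Alloc n) (z : ℕ) : (TBall a z).Finite := by
  have : TBall a z ⊆ Set.Icc (0 : Fin n → ℕ) (fun _ => ∑ i, a.1 i) ×ˢ Set.Icc (0 : Fin n → ℕ) (fun _ => ∑ i, a.2 i) := by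
    rintro w ⟨ht, -⟩
    refine ⟨⟨fun k => Nat.zero_le _, fun k => ?_⟩, ⟨fun k => Nat.zero_le _, fun k => ?_⟩⟩
    · rw [← ht.1]
      exact Finset.single_le_sum (f := w.1) (fun k _ => Nat.zero_le _) (Finset.mem_univ k)
    · rw [← ht.2]
      exact Finset.single_le_sum (f := w.2) (fun k _ => Nat.zero_le _) (Finset.mem_univ k)
  exact ((Set.finite_Icc _ _).prod (Set.finite_Icc _ _)).subset this

theorem exists_ball_min {n : ℕ} {c : Fin n → ℕ → ℕ → ℝ} (hc : ∀ i, Multimodular (c i))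
    {a : Alloc n} (hopt : BikeOptimal c a) (z : ℕ) :
    ∃ x ∈ ball a z, ∀ y ∈ TBall a z, obj c x ≤ obj c y := by
  induction z with
  | zero =>
    refine ⟨a, rfl, ?_⟩
    rintro y ⟨ht, he⟩
    have h0 : ∀ k, y.1 k + y.2 k ≤ a.1 k + a.2 k := by
      intro k
      have := Finset.single_le_sum (f := fun k => (y.1 k + y.2 k) - (a.1 k + a.2 k))
        (fun k _ => Nat.zero_le _) (Finset.mem_univ k)
      unfold excess at he
      omega
    refine hopt y (fun i => ?_) ht.2
    by_contra hne
    have hD : ∑ k, (y.1 k + y.2 k) = ∑ k, (a.1 k + a.2 k) := by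
      rw [Finset.sum_add_distrib, Finset.sum_add_distrib, ht.1, ht.2]
    obtain ⟨j, hj⟩ := exists_lt_of_sum hD (lt_of_le_of_ne (h0 i) hne)
    have := h0 j
    omega
  | succ z ih =>
    obtain ⟨x, hx, hmin⟩ := ih
    have hxT := ball_sub_TBall a z hx
    obtain ⟨w, hw, hwmin⟩ := (TBall_finite a (z+1)).exists_minimalFor (obj c) _
      ⟨x, hxT.1, hxT.2.trans (Nat.le_succ z)⟩
    have hwmin' : ∀ y ∈ TBall a (z+1), obj c w ≤ obj c y := by
      intro y hy
      rcases le_total (obj c w) (obj c y) with h | h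
      · exact h
      · exact hwmin hy h
    rcases exchange_s10 hc hxT hmin _ w hw le_rfl with h | ⟨u, hu, h⟩
    · exact ⟨x, Or.inl hx, fun y hy => h.trans (hwmin' y hy)⟩
    · refine ⟨u, Or.inr ?_, fun y hy => h.trans (hwmin' y hy)⟩
      simp only [Set.mem_iUnion]
      exact ⟨x, hx, hu⟩

theorem self_mem_nbhd {n : ℕ} {x y : Alloc n} (h : y ∈ Neighborhood x) : x ∈ Neighborhood x := by
  have key1 : ∀ i, 1 ≤ x.1 i → x ∈ Neighborhood x := by
    intro i hi
    refine nbhd_mem i i (Or.inl ⟨hi, Prod.ext (funext fun k => ?_) rfl⟩)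
    have := moveOne_add x.1 i hi k
    dsimp only; omega
  have key2 : ∀ i, 1 ≤ x.2 i → x ∈ Neighborhood x := by
    intro i hi
    refine nbhd_mem i i (Or.inr (Or.inl ⟨hi, Prod.ext rfl (funext fun k => ?_)⟩))
    have := moveOne_add x.2 i hi k
    dsimp only; omega
  obtain ⟨i, j, h⟩ := mem_nbhd h
  rcases h with ⟨h1, -⟩ | ⟨h1, -⟩ | ⟨h, h1, -⟩ | ⟨h, h1, -⟩
  · exact key1 _ h1
  · exact key2 _ h1
  · exact key1 _ h1
  · exact key1 _ h1

/-- If `a^z` minimizes the objective over `S_z(a)` and `a^{z+1}` is a minimizer of the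
objective over `N(a^z)`, then `a^{z+1}` is a local optimum within `S_{z+1}(a)`. -/
theorem gradient_step_local_optimum {n : ℕ} (c : Fin n → ℕ → ℕ → ℝ)
    (hc : ∀ i, Multimodular (c i)) (a az az1 : Alloc n) (z : ℕ)
    (hopt : BikeOptimal c a)
    (hzmem : az ∈ ball a z) (hzmin : ∀ x ∈ ball a z, obj c az ≤ obj c x)
    (h1mem : az1 ∈ Neighborhood az)
    (h1min : ∀ x ∈ Neighborhood az, obj c az1 ≤ obj c x) :
    ∀ x ∈ Neighborhood az1 ∩ ball a (z + 1), obj c az1 ≤ obj c x := by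
  rintro x ⟨-, hx⟩
  obtain ⟨x0, hx0, hx0min⟩ := exists_ball_min hc hopt z
  have hmin : ∀ y ∈ TBall a z, obj c az ≤ obj c y :=
    fun y hy => (hzmin x0 hx0).trans (hx0min y hy)
  rcases exchange_s10 hc (ball_sub_TBall a z hzmem) hmin _ x (ball_sub_TBall a (z+1) hx) le_rfl with
    h | ⟨u, hu, h⟩
  · exact (h1min az (self_mem_nbhd h1mem)).trans h
  · exact (h1min u hu).trans h
end

section
/- Let (d⃗^0,b⃗^0) = (d⃗,b⃗) be a bike-optimal allocation, and for each t ≥ 0 let (d⃗^{t+1},b⃗^{t+1}) be a minimizer of c over N(d⃗^t,b⃗^t) ∪ {(d⃗^t,b⃗^t)} (the discrete gradient-descent step). Then for every z ≥ 0, the allocation (d⃗^z,b⃗^z) minimizes the objective c over the z-ball S_z(d⃗,b⃗). -/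
theorem moveOne_spec {n : ℕ} (v : Fin n → ℕ) (i j : Fin n) (h : 1 ≤ v i) (k : Fin n) :
    moveOne v i j k + (if k = i then 1 else 0) = v k + (if k = j then 1 else 0) := by
  unfold moveOne
  by_cases hk : k = i
  · subst hk
    simp only [if_true]
    omega
  · simp [hk]

theorem moveOne_sum {n : ℕ} (v : Fin n → ℕ) (i j : Fin n) (h : 1 ≤ v i) :
    ∑ k, moveOne v i j k = ∑ k, v k := by
  have h1 := Finset.sum_congr (rfl : (Finset.univ : Finset (Fin n)) = Finset.univ)
    (fun k _ => moveOne_spec v i j h k)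
  simpa [Finset.sum_add_distrib] using h1

/-- Effect of a dock-move on totals and on capacities. -/
theorem move_spec {n : ℕ} {a a' : Alloc n} {i j : Fin n} (h : a' ∈ MoveFromTo a i j) :
    ∑ k, a'.1 k = ∑ k, a.1 k ∧ ∑ k, a'.2 k = ∑ k, a.2 k ∧
    ∀ k, (a'.1 k + a'.2 k) + (if k = i then 1 else 0)
      = (a.1 k + a.2 k) + (if k = j then 1 else 0) := by
  rcases h with ⟨h1, rfl⟩ | ⟨h1, rfl⟩ | ⟨g, h1, h2, rfl⟩ | ⟨g, h1, h2, rfl⟩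
  · refine ⟨moveOne_sum _ _ _ h1, rfl, fun k => ?_⟩
    have := moveOne_spec a.1 i j h1 k
    simp only
    omega
  · refine ⟨rfl, moveOne_sum _ _ _ h1, fun k => ?_⟩
    have := moveOne_spec a.2 i j h1 k
    simp only
    omega
  · refine ⟨moveOne_sum _ _ _ h1, moveOne_sum _ _ _ h2, fun k => ?_⟩
    have := moveOne_spec a.1 i g h1 k
    have := moveOne_spec a.2 g j h2 k
    simp only
    omega
  · refine ⟨moveOne_sum _ _ _ h1, moveOne_sum _ _ _ h2, fun k => ?_⟩
    have := moveOne_spec a.1 g j h1 k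
    have := moveOne_spec a.2 i g h2 k
    simp only
    omega

theorem Multimodular.flip {f : ℕ → ℕ → ℝ} (hf : Multimodular f) :
    Multimodular (fun d b => f b d) := by
  obtain ⟨h1, h2, h3⟩ := hf
  refine ⟨fun d b => ?_, fun d b => ?_, fun d b => ?_⟩
  · have := h1 b d
    simp only
    linarith
  · have := h3 b d
    simp only
    linarith
  · have := h2 b d
    simp only
    linarith

theorem mm_dd {f : ℕ → ℕ → ℝ} (hf : Multimodular f) (d b m : ℕ) :
    ∀ b', b ≤ b' + m → f (d+1) b - f d b ≤ f (d+m+1) b' - f (d+m) b' := by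
  obtain ⟨h1, h2, h3⟩ := hf
  induction m with
  | zero =>
    intro b' hb
    induction b', hb using Nat.le_induction with
    | base => exact le_refl _
    | succ k hk ih =>
      have := h1 d k
      simp only [Nat.add_zero] at ih ⊢
      linarith
  | succ m ih =>
    intro b' hb
    have e1 := ih (b'+1) (by omega)
    have e2 := h3 (d+m) b'
    have e : d + (m+1) = d + m + 1 := by omega
    rw [e]
    linarith

/-- Exchange of a unit of the first coordinate. -/
theorem mm_S1 {f : ℕ → ℕ → ℝ} (hf : Multimodular f) {p q r s : ℕ} (h1 : r < p)
    (h2 : r + s < p + q) : f (p-1) q + f (r+1) s ≤ f p q + f r s := by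
  obtain ⟨m, rfl⟩ : ∃ m, p = r + m + 1 := ⟨p - r - 1, by omega⟩
  have := mm_dd hf r s m q (by omega)
  simp only [Nat.add_sub_cancel]
  linarith

theorem mm_S2 {f : ℕ → ℕ → ℝ} (hf : Multimodular f) {p q r s : ℕ} (h1 : s < q)
    (h2 : r + s < p + q) : f p (q-1) + f r (s+1) ≤ f p q + f r s :=
  mm_S1 hf.flip h1 (by omega)

/-- Exchange of a unit of the first coordinate against one of the second. -/
theorem mm_S3 {f : ℕ → ℕ → ℝ} (hf : Multimodular f) {p q r s : ℕ} (h1 : r < p)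
    (h2 : q < s) : f (p-1) (q+1) + f (r+1) (s-1) ≤ f p q + f r s := by
  obtain ⟨m, rfl⟩ : ∃ m, p = r + m + 1 := ⟨p - r - 1, by omega⟩
  obtain ⟨l, rfl⟩ : ∃ l, s = q + l + 1 := ⟨s - q - 1, by omega⟩
  simp only [Nat.add_sub_cancel]
  obtain ⟨-, g2, g3⟩ := hf
  have A : ∀ m, f (r+1) q - f r (q+1) ≤ f (r+m+1) q - f (r+m) (q+1) := by
    intro m
    induction m with
    | zero => exact le_refl _
    | succ m ih =>
      have := g3 (r+m) q
      have e : r + (m+1) = r + m + 1 := by omega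
      rw [e]
      linarith
  have B : ∀ l, f (r+1) (q+l) - f r (q+l+1) ≤ f (r+1) q - f r (q+1) := by
    intro l
    induction l with
    | zero => exact le_refl _
    | succ l ih =>
      have := g2 r (q+l)
      have e : q + (l+1) = q + l + 1 := by omega
      rw [e]
      linarith
  have := A m
  have := B l
  linarith

/-- Exchange when the surplus station has surplus of the first coordinate. -/
theorem exchange_d {n : ℕ} (c : Fin n → ℕ → ℕ → ℝ) (hc : ∀ i, Multimodular (c i))
    (x y : Alloc n) (hs1 : ∑ k, x.1 k = ∑ k, y.1 k) (hs2 : ∑ k, x.2 k = ∑ k, y.2 k)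
    (i : Fin n) (hi : y.1 i + y.2 i < x.1 i + x.2 i) (hid : y.1 i < x.1 i) :
    ∃ j, x.1 j + x.2 j < y.1 j + y.2 j ∧ ∃ x' ∈ MoveFromTo x i j, ∃ y' ∈ MoveFromTo y j i,
      obj c x' + obj c y' ≤ obj c x + obj c y := by
  by_cases ho : ∃ j, x.1 j < y.1 j ∧ x.1 j + x.2 j < y.1 j + y.2 j
  · obtain ⟨j, hj1, hj2⟩ := ho
    refine ⟨j, hj2, (moveOne x.1 i j, x.2), Or.inl ⟨by omega, rfl⟩,
      (moveOne y.1 j i, y.2), Or.inl ⟨by omega, rfl⟩, ?_⟩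
    have hij : i ≠ j := by rintro rfl; omega
    unfold obj
    rw [← Finset.sum_add_distrib, ← Finset.sum_add_distrib]
    refine Finset.sum_le_sum fun k _ => ?_
    simp only [moveOne]
    by_cases hki : k = i
    · subst hki
      simpa [hij] using mm_S1 (hc k) hid hi
    · by_cases hkj : k = j
      · subst hkj
        have := mm_S1 (hc k) hj1 hj2
        simp [hki]
        linarith
      · simp [hki, hkj]
  · push Not at ho
    obtain ⟨h, -, hh⟩ : ∃ h ∈ Finset.univ, x.1 h < y.1 h := by
      by_contra! hcon
      have := Finset.sum_lt_sum hcon ⟨i, Finset.mem_univ i, hid⟩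
      omega
    obtain ⟨j, -, hj⟩ : ∃ j ∈ Finset.univ, x.1 j + x.2 j < y.1 j + y.2 j := by
      by_contra! hcon
      have := Finset.sum_lt_sum hcon ⟨i, Finset.mem_univ i, hi⟩
      simp only [Finset.sum_add_distrib] at this
      omega
    have hh2 := ho h hh
    have hj1 : y.1 j ≤ x.1 j := by
      by_contra! hcon
      have := ho j hcon
      omega
    have hij : i ≠ j := by rintro rfl; omega
    have hih : i ≠ h := by rintro rfl; omega
    have hjh : j ≠ h := by rintro rfl; omega
    refine ⟨j, hj, (moveOne x.1 i h, moveOne x.2 h j),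
      Or.inr (Or.inr (Or.inl ⟨h, by omega, by omega, rfl⟩)),
      (moveOne y.1 h i, moveOne y.2 j h),
      Or.inr (Or.inr (Or.inr ⟨h, by omega, by omega, rfl⟩)), ?_⟩
    unfold obj
    rw [← Finset.sum_add_distrib, ← Finset.sum_add_distrib]
    refine Finset.sum_le_sum fun k _ => ?_
    simp only [moveOne]
    by_cases hki : k = i
    · subst hki
      simpa [hij, hih] using mm_S1 (hc k) hid hi
    · by_cases hkj : k = j
      · subst hkj
        have := mm_S2 (hc k) (show x.2 k < y.2 k by omega) hj
        simp [hki, hjh]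
        linarith
      · by_cases hkh : k = h
        · subst hkh
          have := mm_S3 (hc k) hh (show y.2 k < x.2 k by omega)
          simp [hki, hkj]
          linarith
        · simp [hki, hkj, hkh]

theorem move_swap {n : ℕ} {a a' : Alloc n} {i j : Fin n}
    (h : a' ∈ MoveFromTo a.swap i j) : a'.swap ∈ MoveFromTo a i j := by
  rcases h with ⟨h1, rfl⟩ | ⟨h1, rfl⟩ | ⟨g, h1, h2, rfl⟩ | ⟨g, h1, h2, rfl⟩
  · exact Or.inr (Or.inl ⟨h1, rfl⟩)
  · exact Or.inl ⟨h1, rfl⟩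
  · exact Or.inr (Or.inr (Or.inr ⟨g, h2, h1, rfl⟩))
  · exact Or.inr (Or.inr (Or.inl ⟨g, h2, h1, rfl⟩))

/-- M-convex style exchange realized by single dock-moves. -/
theorem exchange_s12 {n : ℕ} (c : Fin n → ℕ → ℕ → ℝ) (hc : ∀ i, Multimodular (c i))
    (x y : Alloc n) (hs1 : ∑ k, x.1 k = ∑ k, y.1 k) (hs2 : ∑ k, x.2 k = ∑ k, y.2 k)
    (i : Fin n) (hi : y.1 i + y.2 i < x.1 i + x.2 i) :
    ∃ j, x.1 j + x.2 j < y.1 j + y.2 j ∧ ∃ x' ∈ MoveFromTo x i j, ∃ y' ∈ MoveFromTo y j i,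
      obj c x' + obj c y' ≤ obj c x + obj c y := by
  by_cases hid : y.1 i < x.1 i
  · exact exchange_d c hc x y hs1 hs2 i hi hid
  · obtain ⟨j, hj, x', hx', y', hy', hle⟩ :=
      exchange_d (fun i d b => c i b d) (fun i => (hc i).flip) x.swap y.swap hs2 hs1 i
        (by simp only [Prod.fst_swap, Prod.snd_swap]; omega)
        (by simp only [Prod.fst_swap]; omega)
    refine ⟨j, ?_, x'.swap, move_swap hx', y'.swap, move_swap hy', hle⟩
    simp only [Prod.fst_swap, Prod.snd_swap] at hj
    omega

/-- Total capacity surplus of `y` relative to `a` (half the dock-move distance). -/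
def surplus {n : ℕ} (a y : Alloc n) : ℕ :=
  ∑ k, ((y.1 k + y.2 k) - (a.1 k + a.2 k))

/-- Allocations with the same totals as `a` and surplus at most `z`. -/
def Near {n : ℕ} (a : Alloc n) (z : ℕ) (y : Alloc n) : Prop :=
  ∑ k, y.1 k = ∑ k, a.1 k ∧ ∑ k, y.2 k = ∑ k, a.2 k ∧ surplus a y ≤ z

theorem surplus_move_le {n : ℕ} {a y y' : Alloc n} {i j : Fin n}
    (h : y' ∈ MoveFromTo y i j) : surplus a y' ≤ surplus a y + 1 := by
  have hs := (move_spec h).2.2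
  have : ∑ k, ((y'.1 k + y'.2 k) - (a.1 k + a.2 k)) ≤
      ∑ k, (((y.1 k + y.2 k) - (a.1 k + a.2 k)) + (if k = j then 1 else 0)) := by
    refine Finset.sum_le_sum fun k _ => ?_
    have := hs k
    omega
  simpa [Finset.sum_add_distrib, surplus] using this

theorem surplus_move_le' {n : ℕ} {a y y' : Alloc n} {i j : Fin n}
    (h : y' ∈ MoveFromTo y i j) (hi : a.1 i + a.2 i < y.1 i + y.2 i) :
    surplus a y' ≤ surplus a y := by
  have hs := (move_spec h).2.2
  have : ∑ k, (((y'.1 k + y'.2 k) - (a.1 k + a.2 k)) + (if k = i then 1 else 0)) ≤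
      ∑ k, (((y.1 k + y.2 k) - (a.1 k + a.2 k)) + (if k = j then 1 else 0)) := by
    refine Finset.sum_le_sum fun k _ => ?_
    have := hs k
    by_cases hk : k = i
    · subst hk
      simp only [if_true] at *
      omega
    · simp only [hk, if_false] at *
      omega
  simpa [Finset.sum_add_distrib, surplus] using this

theorem surplus_move_lt {n : ℕ} {a y y' : Alloc n} {i j : Fin n}
    (h : y' ∈ MoveFromTo y i j) (hi : a.1 i + a.2 i < y.1 i + y.2 i)
    (hj : y.1 j + y.2 j < a.1 j + a.2 j) :
    surplus a y' + 1 ≤ surplus a y := by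
  have hs := (move_spec h).2.2
  have : ∑ k, (((y'.1 k + y'.2 k) - (a.1 k + a.2 k)) + (if k = i then 1 else 0)) ≤
      ∑ k, ((y.1 k + y.2 k) - (a.1 k + a.2 k)) := by
    refine Finset.sum_le_sum fun k _ => ?_
    have := hs k
    by_cases hk : k = i
    · subst hk
      have hkj : k ≠ j := by rintro rfl; omega
      simp only [if_true, hkj, if_false] at *
      omega
    · by_cases hkj : k = j
      · subst hkj
        simp only [hk, if_true, if_false] at *
        omega
      · simp only [hk, hkj, if_false] at *
        omega
  simpa [Finset.sum_add_distrib, surplus] using this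

theorem near_of_ball {n : ℕ} (a : Alloc n) (z : ℕ) : ∀ y ∈ ball a z, Near a z y := by
  induction z with
  | zero =>
    intro y hy
    obtain rfl : y = a := hy
    exact ⟨rfl, rfl, by simp [surplus]⟩
  | succ z ih =>
    intro y hy
    rcases hy with hy | hy
    · obtain ⟨h1, h2, h3⟩ := ih y hy
      exact ⟨h1, h2, by omega⟩
    · simp only [Set.mem_iUnion, Neighborhood] at hy
      obtain ⟨w, hw, i, j, hm⟩ := hy
      obtain ⟨h1, h2, h3⟩ := ih w hw
      obtain ⟨m1, m2, -⟩ := move_spec hm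
      have := surplus_move_le (a := a) hm
      exact ⟨by omega, by omega, by omega⟩

theorem near_zero {n : ℕ} {c : Fin n → ℕ → ℕ → ℝ} {a y : Alloc n} (hopt : BikeOptimal c a)
    (hy : Near a 0 y) : obj c a ≤ obj c y := by
  obtain ⟨h1, h2, h3⟩ := hy
  refine hopt y ?_ h2
  have hz : ∀ k ∈ Finset.univ, y.1 k + y.2 k - (a.1 k + a.2 k) = 0 :=
    Finset.sum_eq_zero_iff.mp (Nat.le_zero.mp h3)
  have hle : ∀ k ∈ Finset.univ, y.1 k + y.2 k ≤ a.1 k + a.2 k := by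
    intro k hk
    have := hz k hk
    omega
  have := (Finset.sum_eq_sum_iff_of_le hle).mp (by
    simp only [Finset.sum_add_distrib]
    omega)
  exact fun i => this i (Finset.mem_univ i)

/-- The induction step. -/
theorem near_step {n : ℕ} (c : Fin n → ℕ → ℕ → ℝ) (hc : ∀ i, Multimodular (c i))
    (a x x' : Alloc n) (z : ℕ) (hx : Near a z x)
    (hmin : ∀ y, Near a z y → obj c x ≤ obj c y)
    (hx' : ∀ y ∈ Neighborhood x ∪ {x}, obj c x' ≤ obj c y) :
    ∀ (N : ℕ) (y : Alloc n), surplus x y ≤ N → Near a (z+1) y → obj c x' ≤ obj c y := by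
  have hself : obj c x' ≤ obj c x := hx' x (Or.inr rfl)
  intro N
  induction N with
  | zero =>
    intro y hN hy
    by_cases hz : surplus a y ≤ z
    · exact hself.trans (hmin y ⟨hy.1, hy.2.1, hz⟩)
    · exfalso
      have hz0 : ∀ k ∈ Finset.univ, y.1 k + y.2 k - (x.1 k + x.2 k) = 0 :=
        Finset.sum_eq_zero_iff.mp (Nat.le_zero.mp hN)
      have : surplus a y ≤ surplus a x := by
        refine Finset.sum_le_sum fun k hk => ?_
        have := hz0 k hk
        omega
      have := hx.2.2
      omega
  | succ N ih =>
    intro y hN hy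
    by_cases hz : surplus a y ≤ z
    · exact hself.trans (hmin y ⟨hy.1, hy.2.1, hz⟩)
    obtain ⟨y1, y2, y3⟩ := hy
    obtain ⟨x1, x2, x3⟩ := hx
    obtain ⟨k, -, hk⟩ : ∃ k ∈ Finset.univ,
        x.1 k + x.2 k - (a.1 k + a.2 k) < y.1 k + y.2 k - (a.1 k + a.2 k) := by
      refine Finset.exists_lt_of_sum_lt ?_
      change surplus a x < surplus a y
      omega
    obtain ⟨l, hl, yh, hyh, xh, hxh, hle⟩ :=
      exchange_s12 c hc y x (by omega) (by omega) k (by omega)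
    obtain ⟨p1, p2, -⟩ := move_spec hyh
    obtain ⟨q1, q2, -⟩ := move_spec hxh
    have hxN : obj c x' ≤ obj c xh := by
      refine hx' xh (Or.inl ?_)
      simp only [Neighborhood, Set.mem_iUnion]
      exact ⟨l, k, hxh⟩
    by_cases hla : y.1 l + y.2 l < a.1 l + a.2 l
    · have := surplus_move_lt (a := a) hyh (by omega) hla
      have := hmin yh ⟨by omega, by omega, by omega⟩
      linarith
    · have s1 := surplus_move_le' (a := a) hxh (by omega)
      have h1 := hmin xh ⟨by omega, by omega, by omega⟩
      have s2 := surplus_move_le' (a := a) hyh (by omega)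
      have s3 := surplus_move_lt (a := x) hyh (by omega) hl
      have h2 := ih yh (by omega) ⟨by omega, by omega, by omega⟩
      linarith

/-- Starting from a bike-optimal allocation, the discrete gradient-descent sequence
(each step a minimizer of the objective over the neighborhood together with the current
point) reaches, after `z` steps, a minimizer of the objective over the `z`-ball `S_z`. -/
theorem gradient_descent_optimal {n : ℕ} (c : Fin n → ℕ → ℕ → ℝ)
    (hc : ∀ i, Multimodular (c i)) (a : Alloc n) (hopt : BikeOptimal c a)
    (seq : ℕ → Alloc n) (h0 : seq 0 = a)
    (hstep : ∀ t, seq (t + 1) ∈ Neighborhood (seq t) ∪ {seq t} ∧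
      ∀ x ∈ Neighborhood (seq t) ∪ {seq t}, obj c (seq (t + 1)) ≤ obj c x) :
    ∀ z : ℕ, seq z ∈ ball a z ∧ ∀ x ∈ ball a z, obj c (seq z) ≤ obj c x := by
  have key : ∀ z : ℕ, seq z ∈ ball a z ∧ ∀ y, Near a z y → obj c (seq z) ≤ obj c y := by
    intro z
    induction z with
    | zero =>
      refine ⟨h0, fun y hy => ?_⟩
      rw [h0]
      exact near_zero hopt hy
    | succ z ih =>
      obtain ⟨hm, hmin⟩ := ih
      obtain ⟨hs1, hs2⟩ := hstep z
      refine ⟨?_, fun y hy => near_step c hc a (seq z) (seq (z+1)) z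
        (near_of_ball a z _ hm) hmin hs2 _ y le_rfl hy⟩
      rcases hs1 with hs1 | hs1
      · refine Or.inr ?_
        simp only [Set.mem_iUnion]
        exact ⟨seq z, hm, hs1⟩
      · rw [Set.mem_singleton_iff] at hs1
        rw [hs1]
        exact Or.inl hm
  exact fun z => ⟨(key z).1, fun x hx => (key z).2 x (near_of_ball a z x hx)⟩
end
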